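/- There exists a universal constant C > 0 with the following property. Let ν be an isotropic log-concave probability measure on ℝ, let μ = ν^⊗n be the product measure on ℝⁿ, let X ∼ μ, and let f : ℝⁿ → ℝ be a polynomial of degree at most d with coeff_d(f) > 0. Then for every y ∈ ℝ and every ε > 0, P(|f(X) − y| ≤ ε) ≤ C·d·(ε / coeff_d(f))^{1/d}. -/

import Mathlib

open MeasureTheory

/-- The `d`-level content of a multivariate polynomial. -/
noncomputable def coeffd {n : ℕ} (d : ℕ) (f : MvPolynomial (Fin n) ℝ) : ℝ :=
  Real.sqrt (∑ m ∈ f.support.filter (fun m => (∑ i, m i) = d), f.coeff m ^ 2)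

/-- A measure on `ℝ` is log-concave if it has a density `ρ` with respect to Lebesgue measure
satisfying `ρ((1-l)x + ly) ≥ ρ(x)^(1-l) * ρ(y)^l`. -/
def IsLogConcaveMeasure (μ : Measure ℝ) : Prop :=
  ∃ ρ : ℝ → ℝ, (∀ x, 0 ≤ ρ x) ∧
    (∀ x y l : ℝ, 0 ≤ l → l ≤ 1 → ρ x ^ (1 - l) * ρ y ^ l ≤ ρ ((1 - l) * x + l * y)) ∧
    μ = volume.withDensity (fun x => ENNReal.ofReal (ρ x))

/-- The integral of `log⁺ (ℓ / |t - a|)` over the line is at most `2ℓ`. -/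
theorem lintegral_posLog_div_abs_sub_le (ℓ : ℝ) (hl : 0 < ℓ) (a : ℝ) :
    ∫⁻ t : ℝ, ENNReal.ofReal (Real.posLog (ℓ / |t - a|)) ≤ ENNReal.ofReal (2 * ℓ) := by
  rw [lintegral_eq_lintegral_meas_lt _ (Filter.Eventually.of_forall fun _ => Real.posLog_nonneg)
    (by fun_prop)]
  have key : ∀ s ∈ Set.Ioi (0 : ℝ), volume {t : ℝ | s < Real.posLog (ℓ / |t - a|)} ≤
      ENNReal.ofReal (2 * ℓ * Real.exp (-s)) := by
    intro s hs
    have hs : 0 < s := hs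
    have : {t : ℝ | s < Real.posLog (ℓ / |t - a|)} ⊆ Metric.ball a (ℓ * Real.exp (-s)) := by
      intro t ht
      have ht : s < Real.posLog (ℓ / |t - a|) := ht
      rw [Metric.mem_ball, Real.dist_eq]
      rw [Real.posLog, lt_max_iff] at ht
      rcases ht with ht | ht
      · linarith
      have h0 : |t - a| ≠ 0 := by
        intro h; rw [h] at ht; simp at ht; linarith
      have h1 : 0 < |t - a| := lt_of_le_of_ne (abs_nonneg _) (Ne.symm h0)
      rw [Real.lt_log_iff_exp_lt (by positivity), lt_div_iff₀ h1] at ht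
      rw [Real.exp_neg, ← div_eq_mul_inv, lt_div_iff₀ (Real.exp_pos _)]
      linarith
    refine (measure_mono this).trans ?_
    rw [Real.volume_ball]
    exact le_of_eq (by ring_nf)
  refine (setLIntegral_mono' measurableSet_Ioi key).trans ?_
  rw [← ofReal_integral_eq_lintegral_ofReal]
  · rw [integral_const_mul, integral_exp_neg_Ioi_zero]; simp
  · exact (integrableOn_exp_neg_Ioi 0).const_mul _
  · exact Filter.Eventually.of_forall fun s => by positivity

/-- A nonzero real polynomial is, in absolute value, a product of distances to complex roots. -/
theorem Polynomial.abs_eval_eq_prod_norm_sub (P : Polynomial ℝ) :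
    ∃ ζ : Fin P.natDegree → ℂ, ∀ s : ℝ,
      |P.eval s| = |P.leadingCoeff| * ∏ j, ‖(s : ℂ) - ζ j‖ := by
  classical
  set Q := P.map (algebraMap ℝ ℂ) with hQ
  have hsp := IsAlgClosed.splits Q
  have hcard : Q.roots.toList.length = P.natDegree := by
    rw [Multiset.length_toList, ← hsp.natDegree_eq_card_roots, hQ, Polynomial.natDegree_map]
  have hprod : ∀ (S : Multiset ℂ) (f : ℂ → ℂ),
      (S.map f).prod = ∏ i : Fin S.toList.length, f (S.toList.get i) := by
    intro S f
    conv_lhs => rw [← Multiset.coe_toList S]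
    rw [Multiset.map_coe, Multiset.prod_coe, ← List.prod_ofFn]
    congr 1
    apply List.ext_getElem <;> simp
  refine ⟨fun j => Q.roots.toList.get (j.cast hcard.symm), fun s => ?_⟩
  have h1 : Q.eval (s : ℂ) = ((P.eval s : ℝ) : ℂ) := by
    rw [hQ]; exact Polynomial.eval_map_algebraMap _ _ |>.trans (by
      exact Polynomial.aeval_algebraMap_apply_eq_algebraMap_eval s P)
  have h2 := hsp.eval_eq_prod_roots (s : ℂ)
  have h3 : |P.eval s| = ‖Q.eval (s : ℂ)‖ := by rw [h1]; simp
  rw [h3, h2, norm_mul]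
  congr 1
  · simp [hQ]
  · rw [hprod, norm_prod]
    exact Fintype.prod_equiv (finCongr hcard) _ _ (fun j => rfl)

/-- The universal exponential envelope of a normalized log-concave density with maximum one. -/
noncomputable def expEnvelope (s : ℝ) : ℝ := Real.exp (1 - |s| / 3)

/-- The finite measure with density `expEnvelope`. -/
noncomputable def envelopeMeasure : Measure ℝ :=
  volume.withDensity fun s => ENNReal.ofReal (expEnvelope s)

theorem continuous_expEnvelope : Continuous expEnvelope := by
  unfold expEnvelope; fun_prop

theorem integrable_exp_neg_mul_abs {b : ℝ} (hb : 0 < b) :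
    Integrable fun s : ℝ => Real.exp (-(b * |s|)) := by
  have h1 : IntegrableOn (fun s : ℝ => Real.exp (-(b * |s|))) (Set.Ioi 0) := by
    refine (exp_neg_integrableOn_Ioi 0 hb).congr_fun (fun s hs => ?_) measurableSet_Ioi
    simp [abs_of_pos (show (0:ℝ) < s from hs)]
  have h2 : IntegrableOn (fun s : ℝ => Real.exp (-(b * |s|))) (Set.Iic 0) := by
    have := ((integrableOn_Ici_iff_integrableOn_Ioi (by finiteness)).2 h1).comp_neg
    simpa using this
  have := h2.union h1
  rwa [Set.Iic_union_Ioi, integrableOn_univ] at this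

theorem lintegral_posLog_envelope_le (ζ : ℂ) (δ : ℝ) (hδ : 0 < δ) (hδ' : δ ≤ 1 / 2) :
    ∫⁻ s, ENNReal.ofReal (Real.posLog (δ * max 1 ‖ζ‖ / ‖(s : ℂ) - ζ‖)) ∂envelopeMeasure ≤
      ENNReal.ofReal (36 * δ) := by
  set m := max 1 ‖ζ‖ with hm
  have hm1 : 1 ≤ m := le_max_left _ _
  have hm0 : 0 < m := by linarith
  unfold envelopeMeasure
  rw [lintegral_withDensity_eq_lintegral_mul₀ (by have := continuous_expEnvelope; fun_prop)
    (by fun_prop)]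
  have hae : ∀ᵐ s : ℝ, s ≠ ζ.re := by
    simp [ae_iff]
  have key : ∀ᵐ s : ℝ, ((fun s => ENNReal.ofReal (expEnvelope s)) *
      fun s : ℝ => ENNReal.ofReal (Real.posLog (δ * m / ‖(s : ℂ) - ζ‖))) s ≤
      ENNReal.ofReal (18 / m) * ENNReal.ofReal (Real.posLog ((δ * m) / |s - ζ.re|)) := by
    filter_upwards [hae] with s hs
    have h1 : 0 < |s - ζ.re| := abs_pos.2 (sub_ne_zero.2 hs)
    have h2 : |s - ζ.re| ≤ ‖(s : ℂ) - ζ‖ := by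
      have := Complex.abs_re_le_norm ((s : ℂ) - ζ)
      simpa using this
    have h3 : 0 < ‖(s : ℂ) - ζ‖ := h1.trans_le h2
    simp only [Pi.mul_apply]
    rw [← ENNReal.ofReal_mul (by unfold expEnvelope; positivity),
      ← ENNReal.ofReal_mul (by positivity)]
    apply ENNReal.ofReal_le_ofReal
    have hmono : Real.posLog (δ * m / ‖(s : ℂ) - ζ‖) ≤ Real.posLog (δ * m / |s - ζ.re|) := by
      apply Real.posLog_le_posLog (by positivity)
      exact div_le_div_of_nonneg_left (by positivity) h1 h2
    by_cases hlt : δ * m < ‖(s : ℂ) - ζ‖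
    · have : Real.posLog (δ * m / ‖(s : ℂ) - ζ‖) = 0 := by
        rw [Real.posLog_eq_zero_iff, abs_of_pos (by positivity), div_le_one h3]
        exact hlt.le
      rw [this, mul_zero]
      have := Real.posLog_nonneg (x := δ * m / |s - ζ.re|)
      positivity
    · push Not at hlt
      apply mul_le_mul _ hmono Real.posLog_nonneg (by positivity)
      have he : Real.exp 1 ≤ 3 := by linarith [Real.exp_one_lt_d9]
      have hb : m / 2 - 1 / 2  ≤ |s| := by
        have h4 : ‖ζ‖ ≤ ‖(s : ℂ) - ζ‖ + |s| := by
          have := norm_sub_le (s : ℂ) ((s : ℂ) - ζ)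
          simp at this; linarith
        rcases le_total ‖ζ‖ 1 with h5 | h5
        · have : m = 1 := by rw [hm, max_eq_left h5]
          rw [this]; norm_num
        · have : m = ‖ζ‖ := by rw [hm, max_eq_right h5]
          nlinarith
      unfold expEnvelope
      have hx : m / 6  ≤ Real.exp (m / 6 - 1 / 6) := by
        have := Real.add_one_le_exp (m / 6 - 1 / 6); linarith
      have : Real.exp (1 - |s| / 3) ≤ Real.exp 1 * (Real.exp (m / 6 - 1 / 6))⁻¹ := by
        rw [← Real.exp_neg, ← Real.exp_add]
        apply Real.exp_le_exp.2; linarith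
      refine this.trans ?_
      rw [← div_eq_mul_inv, div_le_div_iff₀ (Real.exp_pos _) hm0]
      nlinarith
  refine (lintegral_mono_ae key).trans ?_
  rw [lintegral_const_mul _ (by fun_prop)]
  refine (mul_le_mul_right (lintegral_posLog_div_abs_sub_le (δ * m)
    (by positivity) ζ.re) _).trans ?_
  rw [← ENNReal.ofReal_mul (by positivity)]
  apply ENNReal.ofReal_le_ofReal
  apply le_of_eq
  field_simp
  ring

/-- Small-ball bound for products of distances under a measure below the envelope. -/
theorem measure_prod_norm_sub_le {η : Measure ℝ} [IsProbabilityMeasure η]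
    (hη : η ≤ envelopeMeasure) {k d : ℕ} (hkd : k ≤ d) (hd : 0 < d) {a : ℝ} (ha : 0 < a)
    (ζ : Fin k → ℂ) {ε : ℝ} (hε : 0 < ε) :
    η {s | a * ∏ j, ‖(s : ℂ) - ζ j‖ ≤ ε} ≤
      ENNReal.ofReal (108 * (ε / (a * ∏ j, max 1 ‖ζ j‖)) ^ ((1 : ℝ) / d)) := by
  set N := a * ∏ j, max 1 ‖ζ j‖ with hN
  have hmpos : ∀ j, 0 < max 1 ‖ζ j‖ := fun j => lt_max_of_lt_left one_pos
  have hN0 : 0 < N := mul_pos ha (Finset.prod_pos fun j _ => hmpos j)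
  set e' := (ε / N) ^ ((1 : ℝ) / d) with he'
  have he0 : 0 < e' := by positivity
  have hd0 : (0 : ℝ) < d := by exact_mod_cast hd
  have he : Real.exp 1 ≤ 3 := by linarith [Real.exp_one_lt_d9]
  have he2 : (1:ℝ) ≤ Real.exp 1 := Real.one_le_exp (by norm_num)
  by_cases hbig : 1 / 2 < Real.exp 1 * e'
  · refine prob_le_one.trans ?_
    rw [← ENNReal.ofReal_one]
    apply ENNReal.ofReal_le_ofReal
    nlinarith
  push Not at hbig
  have he1 : e' < 1 := by nlinarith
  have hεN : ε < N := by
    by_contra h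
    push Not at h
    have : 1 ≤ e' := Real.one_le_rpow ((one_le_div hN0).2 h) (by positivity)
    linarith
  have hlog : (d : ℝ) * Real.log e' = Real.log ε - Real.log N := by
    rw [he', Real.log_rpow (by positivity), Real.log_div hε.ne' hN0.ne']
    field_simp
  have hlog0 : Real.log e' ≤ 0 := Real.log_nonpos he0.le he1.le
  rcases Nat.eq_zero_or_pos k with rfl | hk
  · have : {s : ℝ | a * ∏ j : Fin 0, ‖(s : ℂ) - ζ j‖ ≤ ε} = ∅ := by
      ext s; simp at hN; simp; linarith
    rw [this]; simp
  have hac : η ≪ volume := (Measure.absolutelyContinuous_of_le hη).trans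
    (withDensity_absolutelyContinuous _ _)
  have hne : ∀ᵐ s : ℝ ∂η, ∀ j, (s : ℂ) ≠ ζ j := by
    apply hac.ae_le
    refine ae_all_iff.2 fun j => ?_
    have : ∀ᵐ s : ℝ, s ≠ (ζ j).re := by simp [ae_iff]
    filter_upwards [this] with s hs h
    exact hs (by rw [← h]; simp)
  set g : ℝ → ENNReal := fun s => ∑ j, ENNReal.ofReal
    (Real.posLog (Real.exp 1 * e' * max 1 ‖ζ j‖ / ‖(s : ℂ) - ζ j‖)) with hg
  have hgm : Measurable g := by
    apply Finset.measurable_fun_sum; intro j _; fun_prop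
  have hsub : {s : ℝ | a * ∏ j, ‖(s : ℂ) - ζ j‖ ≤ ε} ≤ᵐ[η] {s | (k : ENNReal) ≤ g s} := by
    filter_upwards [hne] with s hs hs2
    have hs2 : a * ∏ j, ‖(s : ℂ) - ζ j‖ ≤ ε := hs2
    have hpos : ∀ j, 0 < ‖(s : ℂ) - ζ j‖ := fun j => norm_pos_iff.2 (sub_ne_zero.2 (hs j))
    show (k : ENNReal) ≤ g s
    rw [hg]
    simp only
    rw [← ENNReal.ofReal_sum_of_nonneg (fun j _ => Real.posLog_nonneg), ← ENNReal.ofReal_natCast]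
    apply ENNReal.ofReal_le_ofReal
    have h1 : ∑ j, Real.log (Real.exp 1 * e' * max 1 ‖ζ j‖ / ‖(s : ℂ) - ζ j‖) ≤
        ∑ j, Real.posLog (Real.exp 1 * e' * max 1 ‖ζ j‖ / ‖(s : ℂ) - ζ j‖) :=
      Finset.sum_le_sum fun j _ => le_max_right _ _
    refine le_trans ?_ h1
    have h2 : ∀ j, Real.log (Real.exp 1 * e' * max 1 ‖ζ j‖ / ‖(s : ℂ) - ζ j‖) =
        1 + Real.log e' + (Real.log (max 1 ‖ζ j‖) - Real.log ‖(s : ℂ) - ζ j‖) := by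
      intro j
      rw [Real.log_div (by have := hmpos j; positivity) (hpos j).ne',
        Real.log_mul (by positivity) (hmpos j).ne',
        Real.log_mul (by positivity) he0.ne', Real.log_exp]
      ring
    simp_rw [h2]
    rw [Finset.sum_add_distrib, Finset.sum_sub_distrib, ← Real.log_prod (fun j _ => (hmpos j).ne'),
      ← Real.log_prod (fun j _ => (hpos j).ne')]
    simp only [Finset.sum_const, Finset.card_univ, Fintype.card_fin, nsmul_eq_mul]
    have h3 : Real.log N = Real.log a + Real.log (∏ j, max 1 ‖ζ j‖) :=
      Real.log_mul ha.ne' (Finset.prod_pos fun j _ => hmpos j).ne'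
    have hpp := (Finset.prod_pos fun j (_ : j ∈ Finset.univ) => hpos j)
    have h4 : Real.log a + Real.log (∏ j, ‖(s : ℂ) - ζ j‖) ≤ Real.log ε := by
      rw [← Real.log_mul ha.ne' hpp.ne']
      exact Real.log_le_log (by positivity) hs2
    have h5 : (d : ℝ) * Real.log e' ≤ k * Real.log e' :=
      mul_le_mul_of_nonpos_right (by exact_mod_cast hkd) hlog0
    nlinarith
  refine (measure_mono_ae hsub).trans ?_
  have hk' : (k : ENNReal) ≠ 0 := by exact_mod_cast hk.ne'
  refine (meas_ge_le_lintegral_div hgm.aemeasurable hk' (ENNReal.natCast_ne_top k)).trans ?_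
  rw [ENNReal.div_le_iff hk' (ENNReal.natCast_ne_top k)]
  refine (lintegral_mono' hη le_rfl).trans ?_
  rw [hg, lintegral_finsetSum _ (fun j _ => by fun_prop)]
  refine (Finset.sum_le_sum fun j _ => lintegral_posLog_envelope_le (ζ j) (Real.exp 1 * e')
    (by positivity) hbig).trans ?_
  simp only [Finset.sum_const, Finset.card_univ, Fintype.card_fin, nsmul_eq_mul]
  rw [mul_comm]
  exact mul_le_mul' (ENNReal.ofReal_le_ofReal (by nlinarith)) le_rfl

/-- Moment bound for products of distances under a measure below the envelope. -/
theorem exists_lintegral_prod_norm_sub_sq_le : ∃ A : ℝ, 0 < A ∧ ∀ {η : Measure ℝ},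
    η ≤ envelopeMeasure → ∀ {k d : ℕ}, k ≤ d → 0 < d → ∀ {a : ℝ}, 0 < a → ∀ (ζ : Fin k → ℂ),
    ∫⁻ s, ENNReal.ofReal ((a * ∏ j, ‖(s : ℂ) - ζ j‖) ^ 2) ∂η ≤
      ENNReal.ofReal ((a * ∏ j, max 1 ‖ζ j‖) ^ 2 * (A * d) ^ (2 * d)) := by
  have hint : Integrable fun s : ℝ => Real.exp (7 / 6 - |s| / 6) := by
    have := (integrable_exp_neg_mul_abs (b := 1 / 6) (by norm_num)).const_mul (Real.exp (7 / 6))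
    refine this.congr (Filter.Eventually.of_forall fun s => ?_)
    simp only [← Real.exp_add]; ring_nf
  set A0 := ∫ s : ℝ, Real.exp (7 / 6 - |s| / 6) with hA0
  refine ⟨12 * max 1 A0, by positivity, ?_⟩
  intro η hη k d hkd hd a ha ζ
  have hd0 : (0 : ℝ) < d := by exact_mod_cast hd
  have hmpos : ∀ j, 0 < max 1 ‖ζ j‖ := fun j => lt_max_of_lt_left one_pos
  set N := a * ∏ j, max 1 ‖ζ j‖ with hN
  have hN0 : 0 < N := mul_pos ha (Finset.prod_pos fun j _ => hmpos j)
  refine (lintegral_mono' hη le_rfl).trans ?_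
  unfold envelopeMeasure
  rw [lintegral_withDensity_eq_lintegral_mul₀ (by have := continuous_expEnvelope; fun_prop)
    (by fun_prop)]
  have key : ∀ s : ℝ, ((fun s => ENNReal.ofReal (expEnvelope s)) *
      fun s : ℝ => ENNReal.ofReal ((a * ∏ j, ‖(s : ℂ) - ζ j‖) ^ 2)) s ≤
      ENNReal.ofReal (N ^ 2 * (12 * d) ^ (2 * d) * Real.exp (7 / 6 - |s| / 6)) := by
    intro s
    simp only [Pi.mul_apply]
    rw [← ENNReal.ofReal_mul (by unfold expEnvelope; positivity)]
    apply ENNReal.ofReal_le_ofReal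
    have h1 : a * ∏ j, ‖(s : ℂ) - ζ j‖ ≤ N * (1 + |s|) ^ d := by
      have : ∏ j, ‖(s : ℂ) - ζ j‖ ≤ ∏ j, (max 1 ‖ζ j‖ * (1 + |s|)) := by
        apply Finset.prod_le_prod (fun j _ => norm_nonneg _)
        intro j _
        have h2 := norm_sub_le (s : ℂ) (ζ j)
        simp at h2
        have h3 := le_max_left 1 ‖ζ j‖
        have h4 := le_max_right 1 ‖ζ j‖
        nlinarith [abs_nonneg s]
      rw [Finset.prod_mul_distrib] at this
      simp only [Finset.prod_const, Finset.card_univ, Fintype.card_fin] at this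
      have h5 : (1 + |s|) ^ k ≤ (1 + |s|) ^ d :=
        pow_le_pow_right₀ (by linarith [abs_nonneg s]) hkd
      have hpp := (Finset.prod_pos fun j (_ : j ∈ Finset.univ) => hmpos j)
      calc a * ∏ j, ‖(s : ℂ) - ζ j‖ ≤ a * ((∏ j, max 1 ‖ζ j‖) * (1 + |s|) ^ k) := by gcongr
        _ ≤ a * ((∏ j, max 1 ‖ζ j‖) * (1 + |s|) ^ d) := by gcongr
        _ = _ := by rw [hN]; ring
    have h6 : (1 + |s|) ^ (2 * d) ≤ (12 * d) ^ (2 * d) * Real.exp ((1 + |s|) / 6) := by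
      have h7 : (1 + |s|) ≤ (12 * d) * Real.exp ((1 + |s|) / (12 * d)) := by
        have := Real.add_one_le_exp ((1 + |s|) / (12 * d))
        have h8 : (1 + |s|) / (12 * d) ≤ Real.exp ((1 + |s|) / (12 * d)) := by linarith
        rwa [div_le_iff₀' (by positivity)] at h8
      calc (1 + |s|) ^ (2 * d) ≤ ((12 * d) * Real.exp ((1 + |s|) / (12 * d))) ^ (2 * d) := by
            gcongr
        _ = (12 * d) ^ (2 * d) * Real.exp ((1 + |s|) / 6) := by
          rw [mul_pow, ← Real.exp_nat_mul]
          congr 2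
          push_cast; field_simp; norm_num
    calc expEnvelope s * (a * ∏ j, ‖(s : ℂ) - ζ j‖) ^ 2
        ≤ expEnvelope s * (N * (1 + |s|) ^ d) ^ 2 := by
          unfold expEnvelope; gcongr
      _ = N ^ 2 * (expEnvelope s * (1 + |s|) ^ (2 * d)) := by ring
      _ ≤ N ^ 2 * (expEnvelope s * ((12 * d) ^ (2 * d) * Real.exp ((1 + |s|) / 6))) := by
          unfold expEnvelope; gcongr
      _ = N ^ 2 * (12 * d) ^ (2 * d) * (expEnvelope s * Real.exp ((1 + |s|) / 6)) := by ring
      _ = _ := by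
          unfold expEnvelope; rw [← Real.exp_add]; ring_nf
  refine (lintegral_mono key).trans ?_
  rw [← ofReal_integral_eq_lintegral_ofReal (hint.const_mul _)
    (Filter.Eventually.of_forall fun s => by positivity)]
  apply ENNReal.ofReal_le_ofReal
  rw [integral_const_mul, mul_assoc]
  have h1 : A0 ≤ max 1 A0 ^ (2 * d) :=
    (le_max_right 1 A0).trans (le_self_pow₀ (le_max_left _ _) (by omega))
  calc N ^ 2 * ((12 * d) ^ (2 * d) * A0) ≤ N ^ 2 * ((12 * d) ^ (2 * d) * max 1 A0 ^ (2 * d)) := by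
        gcongr
    _ = _ := by rw [← mul_pow]; ring_nf

/-- Comparison of small-ball probability and second moment of a polynomial of degree at most `d`
under a probability measure below the envelope. -/
theorem exists_smallBall_mul_moment_le : ∃ C : ℝ, 0 < C ∧ ∀ {η : Measure ℝ},
    IsProbabilityMeasure η → η ≤ envelopeMeasure → ∀ {d : ℕ}, 0 < d → ∀ P : Polynomial ℝ,
    P.natDegree ≤ d → ∀ {ε θ τ : ℝ}, 0 < ε → 0 < τ →
    ENNReal.ofReal θ < η {s | |P.eval s| ≤ ε} →
    ENNReal.ofReal τ < ∫⁻ s, ENNReal.ofReal ((P.eval s) ^ 2) ∂η →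
    θ * τ ^ ((1 : ℝ) / (2 * d)) ≤ C * d * ε ^ ((1 : ℝ) / d) := by
  obtain ⟨A, hA, hM⟩ := exists_lintegral_prod_norm_sub_sq_le
  refine ⟨108 * A, by positivity, ?_⟩
  intro η _ hη d hd P hP ε θ τ hε hτ hθ hτ2
  have hd0 : (0 : ℝ) < d := by exact_mod_cast hd
  have hP0 : P ≠ 0 := by
    rintro rfl; simp at hτ2
  obtain ⟨ζ, hζ⟩ := P.abs_eval_eq_prod_norm_sub
  have ha : 0 < |P.leadingCoeff| := abs_pos.2 (Polynomial.leadingCoeff_ne_zero.2 hP0)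
  have h1 := measure_prod_norm_sub_le hη hP hd ha ζ hε
  have h2 := hM hη hP hd ha ζ
  simp_rw [← hζ] at h1 h2
  have hmpos : ∀ j, 0 < max 1 ‖ζ j‖ := fun j => lt_max_of_lt_left one_pos
  set N := |P.leadingCoeff| * ∏ j, max 1 ‖ζ j‖ with hN
  have hN0 : 0 < N := mul_pos ha (Finset.prod_pos fun j _ => hmpos j)
  have h3 : θ < 108 * (ε / N) ^ ((1 : ℝ) / d) :=
    (ENNReal.ofReal_lt_ofReal_iff (by positivity)).1 (hθ.trans_le h1)
  simp_rw [sq_abs] at h2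
  have h4 : τ < N ^ 2 * (A * d) ^ (2 * d) :=
    (ENNReal.ofReal_lt_ofReal_iff (by positivity)).1 (hτ2.trans_le h2)
  have h5 : τ ^ ((1 : ℝ) / (2 * d)) ≤ N ^ ((1 : ℝ) / d) * (A * d) := by
    calc τ ^ ((1 : ℝ) / (2 * d)) ≤ (N ^ 2 * (A * d) ^ (2 * d)) ^ ((1 : ℝ) / (2 * d)) := by
          gcongr
      _ = _ := by
        rw [Real.mul_rpow (by positivity) (by positivity), ← Real.rpow_natCast, ← Real.rpow_natCast,
          ← Real.rpow_mul hN0.le, ← Real.rpow_mul (by positivity)]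
        congr 1
        · congr 1; push_cast; field_simp
        · push_cast
          rw [mul_one_div_cancel (by positivity), Real.rpow_one]
  calc θ * τ ^ ((1 : ℝ) / (2 * d)) ≤ 108 * (ε / N) ^ ((1 : ℝ) / d) * τ ^ ((1 : ℝ) / (2 * d)) := by
        gcongr
    _ ≤ 108 * (ε / N) ^ ((1 : ℝ) / d) * (N ^ ((1 : ℝ) / d) * (A * d)) := by gcongr
    _ = 108 * A * d * ((ε / N) ^ ((1 : ℝ) / d) * N ^ ((1 : ℝ) / d)) := by ring
    _ = _ := by rw [← Real.mul_rpow (by positivity) hN0.le, div_mul_cancel₀ _ hN0.ne']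

/-- Multiplicative log-concavity of a function on a set. -/
def LogConcaveOn {E : Type*} [AddCommGroup E] [Module ℝ E] (s : Set E) (p : E → ℝ) : Prop :=
  ∀ x ∈ s, ∀ y ∈ s, ∀ l : ℝ, 0 ≤ l → l ≤ 1 →
    p x ^ (1 - l) * p y ^ l ≤ p ((1 - l) • x + l • y)

/-- A log-concave weight on an interval decays exponentially away from its maximum. -/
theorem LogConcaveOn.exists_decay {w : ℝ → ℝ} {α β : ℝ} (hw : Continuous w)
    (hw0 : ∀ t, 0 ≤ w t) (hlc : LogConcaveOn (Set.Icc α β) w)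
    (hW : 0 < ∫ t in Set.Icc α β, w t) :
    ∃ t0 ∈ Set.Icc α β, ∃ m > 0, m = w t0 / (∫ t in Set.Icc α β, w t) ∧
      (∀ t ∈ Set.Icc α β, w t ≤ w t0) ∧
      ∀ t ∈ Set.Icc α β, w t / (∫ t in Set.Icc α β, w t) ≤ m * expEnvelope (m * (t - t0)) := by
  have hne : (Set.Icc α β).Nonempty := by
    by_contra h
    rw [Set.not_nonempty_iff_eq_empty] at h
    rw [h] at hW; simp at hW
  obtain ⟨t0, ht0, hmax⟩ := isCompact_Icc.exists_isMaxOn hne hw.continuousOn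
  have hmax : ∀ t ∈ Set.Icc α β, w t ≤ w t0 := fun t ht => hmax ht
  set W := ∫ t in Set.Icc α β, w t with hWdef
  have hM : 0 < w t0 := by
    by_contra h
    push Not at h
    have : W ≤ 0 := setIntegral_nonpos measurableSet_Icc fun t ht => (hmax t ht).trans h
    linarith
  refine ⟨t0, ht0, w t0 / W, by positivity, rfl, hmax, ?_⟩
  intro t ht
  rw [div_mul_eq_mul_div]
  apply div_le_div_of_nonneg_right _ hW.le
  rcases (hw0 t).eq_or_lt with h0 | hpos
  · rw [← h0]; unfold expEnvelope; positivity
  set y := - Real.log (w t / w t0) with hy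
  have hv : w t / w t0 ≤ 1 := (div_le_one hM).2 (hmax t ht)
  have hy0 : 0 ≤ y := by
    rw [hy]; have := Real.log_nonpos (by positivity) hv; linarith
  set r := 1 / max y 1 with hr
  have hmy : 1 ≤ max y 1 := le_max_right _ _
  have hr0 : 0 < r := by positivity
  have hr1 : r ≤ 1 := by rw [hr, div_le_one (by linarith)]; exact hmy
  have hry : r * y ≤ 1 := by
    rw [hr, one_div_mul_eq_div, div_le_one (by linarith)]; exact le_max_left _ _
  have he : Real.exp 1 ≤ 3 := by linarith [Real.exp_one_lt_d9]
  have hlow : ∀ s ∈ Set.uIcc t0 (t0 + r * (t - t0)), s ∈ Set.Icc α β ∧ w t0 / 3 ≤ w s := by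
    intro s hs
    rw [← segment_eq_uIcc, segment_eq_image'] at hs
    obtain ⟨u, ⟨hu0, hu1⟩, rfl⟩ := hs
    set l := u * r with hl
    have hl0 : 0 ≤ l := by positivity
    have hlr : l ≤ r := by nlinarith
    have hl1 : l ≤ 1 := by linarith
    have heq : t0 + u • (t0 + r * (t - t0) - t0) = (1 - l) • t0 + l • t := by
      simp only [smul_eq_mul, hl]; ring
    simp only [heq]
    refine ⟨(convex_Icc α β) ht0 ht (by linarith) hl0 (by ring), ?_⟩
    refine le_trans ?_ (hlc t0 ht0 t ht l hl0 hl1)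
    have h1 : w t = w t0 * Real.exp (-y) := by
      rw [hy, neg_neg, Real.exp_log (by positivity)]; field_simp
    rw [h1, Real.mul_rpow hM.le (Real.exp_pos _).le, ← mul_assoc, ← Real.rpow_add hM,
      ← Real.exp_mul]
    have h2 : 1 - l + l = 1 := by ring
    rw [h2, Real.rpow_one, div_eq_mul_inv]
    gcongr
    have h3 : Real.exp (-1) ≤ Real.exp (-y * l) := Real.exp_le_exp.2 (by nlinarith)
    refine le_trans ?_ h3
    rw [Real.exp_neg]
    exact inv_anti₀ (Real.exp_pos _) he
  have hWge : w t0 / 3 * (r * |t - t0|) ≤ W := by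
    have hint : IntegrableOn w (Set.Icc α β) := hw.continuousOn.integrableOn_compact isCompact_Icc
    have h1 : ∫ s in Set.uIcc t0 (t0 + r * (t - t0)), w s ≤ W :=
      setIntegral_mono_set hint (Filter.Eventually.of_forall hw0)
        (LE.le.eventuallyLE fun s hs => (hlow s hs).1)
    have h2 : ∫ s in Set.uIcc t0 (t0 + r * (t - t0)), w t0 / 3 ≤
        ∫ s in Set.uIcc t0 (t0 + r * (t - t0)), w s := by
      apply setIntegral_mono_on _ _ measurableSet_uIcc (fun s hs => (hlow s hs).2)
      · exact continuous_const.continuousOn.integrableOn_compact isCompact_uIcc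
      · exact hw.continuousOn.integrableOn_compact isCompact_uIcc
    rw [setIntegral_const, measureReal_def, Real.volume_interval,
      ENNReal.toReal_ofReal (abs_nonneg _)] at h2
    have h3 : |t0 + r * (t - t0) - t0| = r * |t - t0| := by
      rw [add_sub_cancel_left, abs_mul, abs_of_pos hr0]
    rw [h3, smul_eq_mul] at h2
    linarith
  have h4 : w t0 / W * |t - t0| / 3 ≤ y + 1 := by
    have h5 : w t0 * |t - t0| / 3 ≤ W * max y 1 := by
      have : w t0 / 3 * (r * |t - t0|) * max y 1 ≤ W * max y 1 := by gcongr
      have h6 : r * max y 1 = 1 := by rw [hr]; field_simp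
      calc w t0 * |t - t0| / 3 = w t0 / 3 * |t - t0| * (r * max y 1) := by rw [h6]; ring
        _ ≤ _ := by linarith
    have h7 : max y 1 ≤ y + 1 := max_le (by linarith) (by linarith)
    have : w t0 / W * |t - t0| / 3 ≤ max y 1 := by
      rw [show w t0 / W * |t - t0| / 3 = (w t0 * |t - t0| / 3) / W by ring, div_le_iff₀ hW]
      linarith
    linarith
  have h8 : w t = w t0 * Real.exp (-y) := by
    rw [hy, neg_neg, Real.exp_log (by positivity)]; field_simp
  rw [h8]
  gcongr
  unfold expEnvelope
  apply Real.exp_le_exp.2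
  rw [abs_mul, abs_of_pos (by positivity : 0 < w t0 / W)]
  linarith

theorem lintegral_comp_mul_sub {m : ℝ} (hm : 0 < m) (t0 : ℝ) {F : ℝ → ENNReal} (hF : Measurable F) :
    ∫⁻ t, ENNReal.ofReal m * F (m * (t - t0)) = ∫⁻ s, F s := by
  rw [lintegral_sub_right_eq_self (fun t => ENNReal.ofReal m * F (m * t)) t0]
  conv_rhs => rw [← Real.smul_map_volume_mul_left hm.ne', lintegral_smul_measure,
    lintegral_map hF (by fun_prop)]
  rw [lintegral_const_mul _ (by fun_prop), abs_of_pos hm, smul_eq_mul]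

/-- The one-dimensional reduction: a log-concave weight cannot give a polynomial both a large
small-ball probability and a large second moment. -/
theorem exists_oneDim_smallBall : ∃ C : ℝ, 0 < C ∧ ∀ {w : ℝ → ℝ} {α β : ℝ}, Continuous w →
    (∀ t, 0 ≤ w t) → LogConcaveOn (Set.Icc α β) w → ∀ {d : ℕ}, 0 < d → ∀ P : Polynomial ℝ,
    P.natDegree ≤ d → ∀ {ε θ τ : ℝ}, 0 < ε → 0 < θ → 0 < τ →
    0 < ∫ t in Set.Icc α β, (max 0 (min 1 (2 - |P.eval t| / ε)) - θ) * w t →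
    0 < ∫ t in Set.Icc α β, ((P.eval t) ^ 2 - τ) * w t →
    θ * τ ^ ((1 : ℝ) / (2 * d)) ≤ C * d * (2 * ε) ^ ((1 : ℝ) / d) := by
  obtain ⟨C, hC, H⟩ := exists_smallBall_mul_moment_le
  refine ⟨C, hC, ?_⟩
  intro w α β hw hw0 hlc d hd P hP ε θ τ hε hθ hτ h1 h2
  have hint : ∀ g : ℝ → ℝ, Continuous g → IntegrableOn (fun t => g t * w t) (Set.Icc α β) :=
    fun g hg => (hg.mul hw).continuousOn.integrableOn_compact isCompact_Icc
  have hintw : IntegrableOn w (Set.Icc α β) := hw.continuousOn.integrableOn_compact isCompact_Icc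
  have hPc : Continuous fun t => P.eval t := P.continuous
  have hψc : Continuous fun t => max 0 (min 1 (2 - |P.eval t| / ε)) := by fun_prop
  have hWnn : 0 ≤ ∫ t in Set.Icc α β, w t := setIntegral_nonneg measurableSet_Icc fun t _ => hw0 t
  have e2 : ∫ t in Set.Icc α β, ((P.eval t) ^ 2 - τ) * w t =
      (∫ t in Set.Icc α β, (P.eval t) ^ 2 * w t) - τ * ∫ t in Set.Icc α β, w t := by
    simp_rw [sub_mul]
    rw [integral_sub (hint _ (by fun_prop)) (hintw.const_mul _), integral_const_mul]
  have e1 : ∫ t in Set.Icc α β, (max 0 (min 1 (2 - |P.eval t| / ε)) - θ) * w t =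
      (∫ t in Set.Icc α β, max 0 (min 1 (2 - |P.eval t| / ε)) * w t) -
        θ * ∫ t in Set.Icc α β, w t := by
    simp_rw [sub_mul]
    rw [integral_sub (hint _ hψc) (hintw.const_mul _), integral_const_mul]
  have hW : 0 < ∫ t in Set.Icc α β, w t := by
    refine lt_of_le_of_ne hWnn fun h => ?_
    have hz : w =ᵐ[volume.restrict (Set.Icc α β)] 0 :=
      (setIntegral_eq_zero_iff_of_nonneg_ae (Filter.Eventually.of_forall hw0) hintw).1 h.symm
    have : ∫ t in Set.Icc α β, ((P.eval t) ^ 2 - τ) * w t = 0 := by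
      rw [integral_eq_zero_of_ae]
      filter_upwards [hz] with t ht
      simp [ht]
    linarith
  obtain ⟨t0, ht0, m, hm, -, -, hdec⟩ := hlc.exists_decay hw hw0 hW
  rw [e1] at h1
  rw [e2] at h2
  clear e1 e2
  set W := ∫ t in Set.Icc α β, w t with hWdef
  set η0 : Measure ℝ := (volume.restrict (Set.Icc α β)).withDensity
    (fun t => ENNReal.ofReal (w t / W)) with hη0
  have hη0int : ∀ g : ℝ → ℝ, Continuous g → (∀ t, 0 ≤ g t) →
      ∫⁻ t, ENNReal.ofReal (g t) ∂η0 = ENNReal.ofReal ((∫ t in Set.Icc α β, g t * w t) / W) := by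
    intro g hg hg0
    rw [hη0, lintegral_withDensity_eq_lintegral_mul₀ (by fun_prop) (by fun_prop), ← integral_div,
      ofReal_integral_eq_lintegral_ofReal ((hint g hg).div_const _)
      (Filter.Eventually.of_forall fun t => by have := hg0 t; have := hw0 t; positivity)]
    apply lintegral_congr fun t => ?_
    simp only [Pi.mul_apply]
    rw [← ENNReal.ofReal_mul (by have := hw0 t; positivity)]
    congr 1; ring
  have hη0p : IsProbabilityMeasure η0 := by
    constructor
    have := hη0int (fun _ => 1) continuous_const (by simp)
    simpa [← hWdef, hW.ne'] using this
  set T : ℝ → ℝ := fun t => m * (t - t0) with hT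
  have hTm : Measurable T := by rw [hT]; fun_prop
  have hle : η0.map T ≤ envelopeMeasure := by
    rw [Measure.le_iff]
    intro S hS
    rw [Measure.map_apply hTm hS, hη0, envelopeMeasure, withDensity_apply _ hS,
      withDensity_apply _ (hTm hS), ← lintegral_indicator hS,
      ← lintegral_comp_mul_sub hm t0
        (Measurable.indicator (by have := continuous_expEnvelope; fun_prop) hS),
      ← lintegral_indicator (hTm hS), ← lintegral_indicator measurableSet_Icc]
    apply lintegral_mono
    intro t
    by_cases htI : t ∈ Set.Icc α β
    · by_cases htS : T t ∈ S
      · simp only [Set.indicator_of_mem htI]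
        rw [Set.indicator_of_mem (by exact htS), Set.indicator_of_mem (by exact htS),
          ← ENNReal.ofReal_mul hm.le]
        exact ENNReal.ofReal_le_ofReal (hdec t htI)
      · simp only [Set.indicator_of_mem htI]
        rw [Set.indicator_of_notMem (by exact htS)]
        simp
    · simp [htI]
  have hηp : IsProbabilityMeasure (η0.map T) := Measure.isProbabilityMeasure_map hTm.aemeasurable
  set Q : Polynomial ℝ := P.comp (Polynomial.C (1 / m) * Polynomial.X + Polynomial.C t0) with hQ
  have hQT : ∀ t, Q.eval (T t) = P.eval t := by
    intro t
    rw [hQ, Polynomial.eval_comp]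
    congr 1
    simp [hT]
    field_simp
    ring
  have hQd : Q.natDegree ≤ d := by
    refine Polynomial.natDegree_comp_le.trans ?_
    have := Polynomial.natDegree_linear_le (a := 1 / m) (b := t0)
    nlinarith
  refine H hηp hle hd Q hQd (ε := 2 * ε) (by positivity) hτ ?_ ?_
  · rw [Measure.map_apply hTm (by
      exact measurableSet_le (by have := Q.continuous; fun_prop) measurable_const)]
    have h3 : T ⁻¹' {s | |Q.eval s| ≤ 2 * ε} = {t | |P.eval t| ≤ 2 * ε} := by
      ext t; simp [hQT]
    rw [h3]
    have h4 : ∫⁻ t, ENNReal.ofReal (max 0 (min 1 (2 - |P.eval t| / ε))) ∂η0 ≤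
        η0 {t | |P.eval t| ≤ 2 * ε} := by
      rw [← lintegral_indicator_one (by
        exact measurableSet_le (by fun_prop) measurable_const)]
      apply lintegral_mono
      intro t
      by_cases ht : |P.eval t| ≤ 2 * ε
      · rw [Set.indicator_of_mem (by exact ht)]
        simp
      · have : max 0 (min 1 (2 - |P.eval t| / ε)) = 0 := by
          apply max_eq_left
          push Not at ht
          refine (min_le_right _ _).trans ?_
          rw [sub_nonpos, le_div_iff₀ hε]
          exact ht.le
        simp [this]
    refine lt_of_lt_of_le ?_ h4
    rw [hη0int _ hψc (fun t => le_max_left _ _)]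
    have : θ < (∫ t in Set.Icc α β, max 0 (min 1 (2 - |P.eval t| / ε)) * w t) / W := by
      rw [lt_div_iff₀ hW]; linarith
    exact (ENNReal.ofReal_lt_ofReal_iff (hθ.trans this)).2 this
  · rw [lintegral_map (by have := Q.continuous; fun_prop) hTm]
    simp_rw [hQT]
    rw [hη0int (fun t => P.eval t ^ 2) (by fun_prop) (fun t => sq_nonneg _)]
    have : τ < (∫ t in Set.Icc α β, P.eval t ^ 2 * w t) / W := by
      rw [lt_div_iff₀ hW]; linarith
    exact (ENNReal.ofReal_lt_ofReal_iff (hτ.trans this)).2 this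

/-- Length of the vertical slice of a planar set, computed from its extreme points. -/
noncomputable def sliceLength (K : Set (ℝ × ℝ)) (x : ℝ) : ℝ :=
  sSup {y | (x, y) ∈ K} - sInf {y | (x, y) ∈ K}

theorem isCompact_slice {K : Set (ℝ × ℝ)} (hK : IsCompact K) (x : ℝ) :
    IsCompact {y | (x, y) ∈ K} := by
  have : {y | (x, y) ∈ K} = Prod.snd '' (K ∩ {q | q.1 = x}) := by
    ext y
    constructor
    · intro hy; exact ⟨(x, y), ⟨hy, rfl⟩, rfl⟩
    · rintro ⟨⟨x', y'⟩, ⟨h1, h2⟩, rfl⟩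
      simp only [Set.mem_ofPred_eq] at h2 ⊢
      rwa [← h2]
  rw [this]
  exact (hK.inter_right (isClosed_eq continuous_fst continuous_const)).image continuous_snd

theorem slice_eq_Icc {K : Set (ℝ × ℝ)} (hK : IsCompact K) (hc : Convex ℝ K) {x : ℝ}
    (hne : {y | (x, y) ∈ K}.Nonempty) :
    {y | (x, y) ∈ K} = Set.Icc (sInf {y | (x, y) ∈ K}) (sSup {y | (x, y) ∈ K}) := by
  apply eq_Icc_of_connected_compact _ (isCompact_slice hK x)
  refine ⟨hne, (Convex.isPreconnected ?_)⟩
  intro y hy y' hy' s t hs ht hst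
  have := hc hy hy' hs ht hst
  simp only [Prod.smul_mk, Prod.mk_add_mk, smul_eq_mul] at this
  rw [← add_mul, hst, one_mul] at this
  exact this

theorem measureReal_slice {K : Set (ℝ × ℝ)} (hK : IsCompact K) (hc : Convex ℝ K) (x : ℝ) :
    volume.real {y | (x, y) ∈ K} = sliceLength K x := by
  rcases Set.eq_empty_or_nonempty {y | (x, y) ∈ K} with h | h
  · unfold sliceLength; rw [h]; simp
  · unfold sliceLength
    have := slice_eq_Icc hK hc h
    rw [measureReal_def]
    conv_lhs => rw [this]
    rw [Real.volume_Icc, ENNReal.toReal_ofReal]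
    exact sub_nonneg.2 (Real.sInf_le_sSup _ (isCompact_slice hK x).bddBelow
      (isCompact_slice hK x).bddAbove)

theorem sliceLength_nonneg {K : Set (ℝ × ℝ)} (hK : IsCompact K) (hc : Convex ℝ K) (x : ℝ) :
    0 ≤ sliceLength K x := by
  rw [← measureReal_slice hK hc]; exact measureReal_nonneg

theorem concaveOn_sliceLength {K : Set (ℝ × ℝ)} (hK : IsCompact K) (hc : Convex ℝ K) :
    ConcaveOn ℝ (Prod.fst '' K) (sliceLength K) := by
  refine ⟨hc.linear_image (LinearMap.fst ℝ ℝ ℝ), ?_⟩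
  rintro _ ⟨⟨x, y⟩, hxy, rfl⟩ _ ⟨⟨x', y'⟩, hxy', rfl⟩ s t hs ht hst
  have hn : {u | (x, u) ∈ K}.Nonempty := ⟨y, hxy⟩
  have hn' : {u | (x', u) ∈ K}.Nonempty := ⟨y', hxy'⟩
  have u1 := (isCompact_slice hK x).sSup_mem hn
  have u2 := (isCompact_slice hK x').sSup_mem hn'
  have l1 := (isCompact_slice hK x).sInf_mem hn
  have l2 := (isCompact_slice hK x').sInf_mem hn'
  have hu := hc u1 u2 hs ht hst
  have hl := hc l1 l2 hs ht hst
  have hcmp := isCompact_slice hK (s • x + t • x')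
  have hu' := le_csSup hcmp.bddAbove (show _ ∈ {u | (s • x + t • x', u) ∈ K} from hu)
  have hl' := csInf_le hcmp.bddBelow (show _ ∈ {u | (s • x + t • x', u) ∈ K} from hl)
  unfold sliceLength
  simp only [smul_eq_mul, Prod.smul_mk] at *
  nlinarith

/-- Fubini over the vertical slices of a compact convex planar set. -/
theorem setIntegral_comp_fst {K : Set (ℝ × ℝ)} (hK : IsCompact K) (hc : Convex ℝ K)
    {φ : ℝ → ℝ} (hφ : Continuous φ) :
    Integrable (fun x => φ x * sliceLength K x) ∧
      ∫ q in K, φ q.1 = ∫ x, φ x * sliceLength K x := by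
  have hint : Integrable (K.indicator fun q : ℝ × ℝ => φ q.1) (volume.prod volume) := by
    rw [← Measure.volume_eq_prod, integrable_indicator_iff hK.measurableSet]
    exact (hφ.comp continuous_fst).continuousOn.integrableOn_compact hK
  have hinner : ∀ x, ∫ y, K.indicator (fun q : ℝ × ℝ => φ q.1) (x, y) = φ x * sliceLength K x := by
    intro x
    have : (fun y => K.indicator (fun q : ℝ × ℝ => φ q.1) (x, y)) =
        {y | (x, y) ∈ K}.indicator fun _ => φ x := by
      ext y; simp [Set.indicator]
    rw [this, integral_indicator (isCompact_slice hK x).measurableSet, setIntegral_const,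
      measureReal_slice hK hc, smul_eq_mul, mul_comm]
  constructor
  · exact hint.integral_prod_left.congr (Filter.Eventually.of_forall fun x => hinner x)
  · rw [← integral_indicator hK.measurableSet, Measure.volume_eq_prod, integral_prod _ hint]
    exact integral_congr_ae (Filter.Eventually.of_forall fun x => hinner x)

/-- A planar segment together with a concave weight on it. -/
def HasNeedle {ι : Type*} (K : Set (ℝ × ℝ)) (g : ι → ℝ × ℝ → ℝ) : Prop :=
  ∃ (a b : ℝ) (c v : ℝ × ℝ) (h : ℝ → ℝ), Continuous h ∧ (∀ t, 0 ≤ h t) ∧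
    ConcaveOn ℝ (Set.Icc a b) h ∧ (∀ t ∈ Set.Icc a b, c + t • v ∈ K) ∧
    ∀ i, 0 < ∫ t in Set.Icc a b, g i (c + t • v) * h t

/-- If the test functions hardly vary along vertical slices of `K`, the mass of `K` may be
transported onto a single segment. -/
theorem hasNeedle_of_vertical {ι : Type*} [Finite ι] {K : Set (ℝ × ℝ)} (hK : IsCompact K)
    (hc : Convex ℝ K) (hvol : 0 < volume.real K) {g : ι → ℝ × ℝ → ℝ} (hg : ∀ i, Continuous (g i))
    {κ : ℝ} (hκ : 0 < κ) (hint : ∀ i, 0 ≤ ∫ q in K, (g i q - κ))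
    (hosc : ∀ i, ∀ z ∈ K, ∀ z' ∈ K, z.1 = z'.1 → |g i z - g i z'| ≤ κ / 2) :
    HasNeedle K g := by
  have hne : K.Nonempty := by
    by_contra h
    rw [Set.not_nonempty_iff_eq_empty] at h
    rw [h] at hvol; simp at hvol
  have hIc : IsCompact (Prod.fst '' K) := hK.image continuous_fst
  have hI : Prod.fst '' K = Set.Icc (sInf (Prod.fst '' K)) (sSup (Prod.fst '' K)) := by
    apply eq_Icc_of_connected_compact _ hIc
    exact ⟨hne.image _, (hc.linear_image (LinearMap.fst ℝ ℝ ℝ)).isPreconnected⟩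
  set a := sInf (Prod.fst '' K) with ha
  set b := sSup (Prod.fst '' K) with hb
  obtain ⟨⟨a', ya⟩, hza, haa⟩ := hIc.sInf_mem (hne.image _)
  obtain ⟨⟨b', yb⟩, hzb, hbb⟩ := hIc.sSup_mem (hne.image _)
  simp only at haa hbb
  rw [← ha] at haa
  rw [← hb] at hbb
  subst haa hbb
  have hvolK := (setIntegral_comp_fst hK hc (φ := fun _ => 1) continuous_const)
  have hcon := concaveOn_sliceLength hK hc
  rw [hI] at hcon
  have hz : ∀ x, x ∉ Set.Icc a b → sliceLength K x = 0 := by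
    intro x hx
    have : {y | (x, y) ∈ K} = ∅ := by
      ext y
      simp only [Set.mem_ofPred_eq, Set.mem_empty_iff_false, iff_false]
      intro hy
      exact hx (hI ▸ ⟨(x, y), hy, rfl⟩)
    unfold sliceLength; rw [this]; simp
  have hab : a < b := by
    by_contra h
    push Not at h
    have h1 : ∫ x, (1:ℝ) * sliceLength K x = 0 := by
      apply integral_eq_zero_of_ae
      have : ∀ᵐ x : ℝ, x ≠ a := by simp [ae_iff]
      filter_upwards [this] with x hx
      simp only [one_mul, Pi.zero_apply]
      apply hz
      rintro ⟨h2, h3⟩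
      exact hx (le_antisymm (h3.trans h) h2)
    rw [← hvolK.2] at h1
    simp at h1
    rw [measureReal_def] at hvol
    rw [measureReal_def] at h1
    linarith
  set v : ℝ × ℝ := (b - a)⁻¹ • ((b, yb) - (a, ya)) with hv
  set c : ℝ × ℝ := (a, ya) - a • v with hcdef
  have hba : b - a ≠ 0 := by linarith
  have hcv1 : ∀ x, (c + x • v).1 = x := by
    intro x
    simp [hcdef, hv]
    field_simp
    ring
  have hcvK : ∀ x ∈ Set.Icc a b, c + x • v ∈ K := by
    intro x hx
    have : c + x • v = (1 - (x - a) / (b - a)) • (a, ya) + ((x - a) / (b - a)) • (b, yb) := by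
      ext
      · simp [hcdef, hv]; field_simp; ring
      · simp [hcdef, hv]; field_simp; ring
    rw [this]
    have h1 : (x - a) / (b - a) ≤ 1 := by
      rw [div_le_one (by linarith)]; linarith [hx.2]
    exact hc hza hzb (by linarith) (div_nonneg (by linarith [hx.1]) (by linarith)) (by ring)
  have hpos : ∀ i, 0 < ∫ x, g i (c + x • v) * sliceLength K x := by
    intro i
    have hφ : Continuous fun x : ℝ => g i (c + x • v) := by have := hg i; fun_prop
    have h1 := setIntegral_comp_fst hK hc (φ := fun x => g i (c + x • v)) hφ
    rw [← h1.2]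
    have hi1 : IntegrableOn (fun q : ℝ × ℝ => g i (c + q.1 • v)) K :=
      (hφ.comp continuous_fst).continuousOn.integrableOn_compact hK
    have hcst : ∀ r : ℝ, IntegrableOn (fun q : ℝ × ℝ => r) K :=
      fun r => continuousOn_const.integrableOn_compact hK
    have h2 : ∫ q in K, (g i q - κ) ≤ ∫ q in K, (g i (c + q.1 • v) - κ / 2) := by
      apply setIntegral_mono_on _ (hi1.sub (hcst _)) hK.measurableSet
      · intro q hq
        have hq1 : q.1 ∈ Set.Icc a b := hI ▸ ⟨q, hq, rfl⟩
        have := hosc i q hq _ (hcvK q.1 hq1) (hcv1 q.1).symm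
        have := (abs_le.1 this).2
        show g i q - κ ≤ g i (c + q.1 • v) - κ / 2
        linarith
      · exact ((hg i).continuousOn.integrableOn_compact hK).sub (hcst _)
    rw [integral_sub hi1 (hcst _), setIntegral_const, smul_eq_mul] at h2
    have := hint i
    have : 0 < volume.real K * (κ / 2) := by positivity
    linarith
  have hIntF : ∀ i, Integrable fun x => g i (c + x • v) * sliceLength K x := fun i =>
    (setIntegral_comp_fst hK hc (φ := fun x => g i (c + x • v))
      (by have := hg i; fun_prop)).1
  have hev : ∀ i, ∀ᶠ δ in nhdsWithin (0:ℝ) (Set.Ioi 0),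
      0 < ∫ x in (a + δ)..(b - δ), g i (c + x • v) * sliceLength K x := by
    intro i
    set F := fun x => g i (c + x • v) * sliceLength K x with hF
    have hII : ∀ x y, IntervalIntegrable F volume x y := fun x y => (hIntF i).intervalIntegrable
    have hcont : Continuous fun δ => ∫ x in (a + δ)..(b - δ), F x := by
      have h1 := intervalIntegral.continuous_primitive hII a
      have : (fun δ => ∫ x in (a + δ)..(b - δ), F x) =
          fun δ => (∫ x in a..(b - δ), F x) - ∫ x in a..(a + δ), F x := by
        ext δ
        rw [intervalIntegral.integral_interval_sub_left (hII _ _) (hII _ _)]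
      rw [this]
      exact (h1.comp (continuous_const.sub continuous_id)).sub
        (h1.comp (continuous_const.add continuous_id))
    have h0 : 0 < ∫ x in (a + 0)..(b - 0), F x := by
      rw [add_zero, sub_zero, intervalIntegral.integral_of_le hab.le,
        ← integral_Icc_eq_integral_Ioc,
        setIntegral_eq_integral_of_forall_compl_eq_zero (fun x hx => by simp [hF, hz x hx])]
      exact hpos i
    exact nhdsWithin_le_nhds (hcont.continuousAt.eventually (lt_mem_nhds h0))
  have hsmall : ∀ᶠ δ in nhdsWithin (0:ℝ) (Set.Ioi 0), δ < (b - a) / 2 :=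
    nhdsWithin_le_nhds (gt_mem_nhds (by linarith))
  obtain ⟨δ, hδ1, hδ2, hδ0⟩ := ((Filter.eventually_all.2 hev).and
    (hsmall.and self_mem_nhdsWithin)).exists
  have hδ0 : 0 < δ := hδ0
  have hle : a + δ ≤ b - δ := by linarith
  have hcontOn : ContinuousOn (sliceLength K) (Set.Icc (a + δ) (b - δ)) := by
    refine hcon.continuousOn_interior.mono ?_
    rw [interior_Icc]
    intro x hx
    exact ⟨by linarith [hx.1], by linarith [hx.2]⟩
  refine ⟨a + δ, b - δ, c, v, Set.IccExtend hle ((Set.Icc (a + δ) (b - δ)).domRestrict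
    (sliceLength K)),
    hcontOn.domRestrict.Icc_extend', ?_, ?_, ?_, ?_⟩
  · intro t
    exact sliceLength_nonneg hK hc _
  · refine (hcon.subset ?_ (convex_Icc _ _)).congr ?_
    · intro x hx
      exact ⟨by linarith [hx.1], by linarith [hx.2]⟩
    · intro x hx
      rw [Set.IccExtend_of_mem _ _ hx]; rfl
  · intro t ht
    exact hcvK t ⟨by linarith [ht.1], by linarith [ht.2]⟩
  · intro i
    have := hδ1 i
    rw [intervalIntegral.integral_of_le hle, ← integral_Icc_eq_integral_Ioc] at this
    refine this.trans_eq (setIntegral_congr_fun measurableSet_Icc fun x hx => ?_)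
    rw [Set.IccExtend_of_mem _ _ hx]; rfl

theorem HasNeedle.mono {ι : Type*} {K Q : Set (ℝ × ℝ)} {g : ι → ℝ × ℝ → ℝ}
    (h : HasNeedle K g) (hKQ : K ⊆ Q) : HasNeedle Q g := by
  obtain ⟨a, b, c, v, w, h1, h2, h3, h4, h5⟩ := h
  exact ⟨a, b, c, v, w, h1, h2, h3, fun t ht => hKQ (h4 t ht), h5⟩

theorem setIntegral_swap (K : Set (ℝ × ℝ)) (f : ℝ × ℝ → ℝ) :
    ∫ q in Prod.swap ⁻¹' K, f q.swap = ∫ q in K, f q := by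
  have : MeasurePreserving (Prod.swap : ℝ × ℝ → ℝ × ℝ) volume volume := by
    rw [Measure.volume_eq_prod]; exact Measure.measurePreserving_swap
  exact this.setIntegral_preimage_emb MeasurableEquiv.prodComm.measurableEmbedding f K

/-- A compact convex set close to a line carries a needle. -/
theorem exists_hasNeedle_of_near_line {ι : Type*} [Finite ι] {Q : Set (ℝ × ℝ)} (hQ : IsCompact Q)
    {g : ι → ℝ × ℝ → ℝ} (hg : ∀ i, Continuous (g i)) {κ : ℝ} (hκ : 0 < κ)
    {u v : ℝ} (hv : v ≠ 0) (c : ℝ) :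
    ∃ δ > 0, ∀ K ⊆ Q, IsCompact K → Convex ℝ K → 0 < volume.real K →
      (∀ i, 0 ≤ ∫ q in K, (g i q - κ)) → (∀ z ∈ K, |u * z.1 + v * z.2 - c| < δ) →
      HasNeedle K g := by
  have huc : ∀ i, ∃ δ > 0, ∀ z ∈ Q, ∀ z' ∈ Q, dist z z' < δ → |g i z - g i z'| ≤ κ / 2 := by
    intro i
    have := Metric.uniformContinuousOn_iff.1
      (hQ.uniformContinuousOn_of_continuous (hg i).continuousOn) (κ / 2) (by positivity)
    obtain ⟨δ, hδ, h⟩ := this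
    exact ⟨δ, hδ, fun z hz z' hz' hd => by
      have := h z hz z' hz' hd
      rw [Real.dist_eq] at this; exact this.le⟩
  choose δ hδ hδ' using huc
  have : ∃ δ0 > 0, ∀ i, δ0 ≤ δ i := by
    cases isEmpty_or_nonempty ι
    · exact ⟨1, one_pos, fun i => isEmptyElim i⟩
    · obtain ⟨i0, hi0⟩ := Finite.exists_min δ
      exact ⟨δ i0, hδ i0, hi0⟩
  obtain ⟨δ0, hδ0, hle⟩ := this
  refine ⟨|v| * δ0 / 2, by have := abs_pos.2 hv; positivity, ?_⟩
  intro K hKQ hK hc hvol hint hnear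
  refine hasNeedle_of_vertical hK hc hvol hg hκ hint ?_
  intro i z hz z' hz' h1
  apply hδ' i z (hKQ hz) z' (hKQ hz')
  refine lt_of_lt_of_le ?_ (hle i)
  have e1 := abs_lt.1 (hnear z hz)
  have e2 := abs_lt.1 (hnear z' hz')
  have h3 : |v * (z.2 - z'.2)| < |v| * δ0 := by
    rw [abs_lt]
    rw [h1] at e1
    constructor <;> nlinarith
  rw [abs_mul] at h3
  have h4 : |z.2 - z'.2| < δ0 := lt_of_mul_lt_mul_left h3 (abs_nonneg _)
  rw [Prod.dist_eq, h1, dist_self, Real.dist_eq]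
  exact max_lt hδ0 h4

theorem HasNeedle.of_swap {ι : Type*} {K : Set (ℝ × ℝ)} {g : ι → ℝ × ℝ → ℝ}
    (h : HasNeedle (Prod.swap ⁻¹' K) (fun i q => g i q.swap)) : HasNeedle K g := by
  obtain ⟨a, b, c, v, w, h1, h2, h3, h4, h5⟩ := h
  refine ⟨a, b, c.swap, v.swap, w, h1, h2, h3, fun t ht => ?_, h5⟩
  exact h4 t ht

theorem exists_hasNeedle_of_near_hyperplane {ι : Type*} [Finite ι] {Q : Set (ℝ × ℝ)}
    (hQ : IsCompact Q) {g : ι → ℝ × ℝ → ℝ} (hg : ∀ i, Continuous (g i)) {κ : ℝ} (hκ : 0 < κ)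
    {u v : ℝ} (huv : u ≠ 0 ∨ v ≠ 0) (c : ℝ) :
    ∃ δ > 0, ∀ K ⊆ Q, IsCompact K → Convex ℝ K → 0 < volume.real K →
      (∀ i, 0 ≤ ∫ q in K, (g i q - κ)) → (∀ z ∈ K, |u * z.1 + v * z.2 - c| < δ) →
      HasNeedle K g := by
  rcases huv with hu | hv
  swap
  · exact exists_hasNeedle_of_near_line hQ hg hκ hv c
  have hQ' : IsCompact (Prod.swap ⁻¹' Q) := (Homeomorph.prodComm ℝ ℝ).isCompact_preimage.2 hQ
  obtain ⟨δ, hδ, H⟩ := exists_hasNeedle_of_near_line hQ' (g := fun i q => g i q.swap)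
    (fun i => (hg i).comp continuous_swap) hκ (u := v) hu c
  refine ⟨δ, hδ, fun K hKQ hK hc hvol hint hnear => HasNeedle.of_swap ?_⟩
  refine H _ (Set.preimage_mono hKQ) ((Homeomorph.prodComm ℝ ℝ).isCompact_preimage.2 hK)
    (hc.linear_preimage (LinearEquiv.prodComm ℝ ℝ ℝ).toLinearMap) ?_ ?_ ?_
  · have := setIntegral_swap K (fun _ => 1)
    simp only [setIntegral_const, smul_eq_mul, mul_one] at this
    rwa [this]
  · intro i
    rw [setIntegral_swap K (fun q => g i q - κ)]
    exact hint i
  · intro z hz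
    have := hnear z.swap hz
    simp only [Prod.fst_swap, Prod.snd_swap] at this
    rwa [add_comm (v * z.1)]

theorem volume_line_eq_zero {u v : ℝ} (huv : u ≠ 0 ∨ v ≠ 0) (c : ℝ) :
    volume {z : ℝ × ℝ | u * z.1 + v * z.2 = c} = 0 := by
  set f : ℝ × ℝ →ₗ[ℝ] ℝ := u • LinearMap.fst ℝ ℝ ℝ + v • LinearMap.snd ℝ ℝ ℝ with hf
  have hfz : ∀ z, f z = u * z.1 + v * z.2 := fun z => by simp [hf]
  rcases Set.eq_empty_or_nonempty {z : ℝ × ℝ | u * z.1 + v * z.2 = c} with h | ⟨z0, hz0⟩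
  · rw [h]; simp
  have hz0 : u * z0.1 + v * z0.2 = c := hz0
  have h1 : {z : ℝ × ℝ | u * z.1 + v * z.2 = c} =
      (fun z => z + -z0) ⁻¹' (LinearMap.ker f : Set (ℝ × ℝ)) := by
    ext z
    simp only [Set.mem_ofPred_eq, Set.mem_preimage, SetLike.mem_coe, LinearMap.mem_ker, hfz,
      Prod.fst_add, Prod.snd_add, Prod.fst_neg, Prod.snd_neg]
    constructor <;> intro h <;> linarith
  rw [h1, measure_preimage_add_right]
  apply Measure.addHaar_submodule
  intro htop
  rw [LinearMap.ker_eq_top] at htop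
  have e1 := hfz (1, 0)
  have e2 := hfz (0, 1)
  rw [htop] at e1 e2
  simp at e1 e2
  tauto

/-- Closed half-plane through `x` with inner normal at angle `θ`. -/
def halfPlane (x : ℝ × ℝ) (θ : ℝ) : Set (ℝ × ℝ) :=
  {z | 0 ≤ Real.cos θ * (z.1 - x.1) + Real.sin θ * (z.2 - x.2)}

theorem isClosed_halfPlane (x : ℝ × ℝ) (θ : ℝ) : IsClosed (halfPlane x θ) :=
  isClosed_le continuous_const (by fun_prop)

theorem convex_halfPlane (x : ℝ × ℝ) (θ : ℝ) : Convex ℝ (halfPlane x θ) := by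
  intro z hz z' hz' s t hs ht hst
  have hz : 0 ≤ Real.cos θ * (z.1 - x.1) + Real.sin θ * (z.2 - x.2) := hz
  have hz' : 0 ≤ Real.cos θ * (z'.1 - x.1) + Real.sin θ * (z'.2 - x.2) := hz'
  show 0 ≤ Real.cos θ * ((s • z + t • z').1 - x.1) + Real.sin θ * ((s • z + t • z').2 - x.2)
  simp only [Prod.fst_add, Prod.smul_fst, Prod.snd_add, Prod.smul_snd, smul_eq_mul]
  have e : Real.cos θ * (s * z.1 + t * z'.1 - x.1) + Real.sin θ * (s * z.2 + t * z'.2 - x.2) =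
      s * (Real.cos θ * (z.1 - x.1) + Real.sin θ * (z.2 - x.2)) +
      t * (Real.cos θ * (z'.1 - x.1) + Real.sin θ * (z'.2 - x.2)) := by
    have : t = 1 - s := by linarith
    subst this; ring
  rw [e]; positivity

theorem cos_ne_or_sin_ne (θ : ℝ) : Real.cos θ ≠ 0 ∨ Real.sin θ ≠ 0 := by
  by_contra h
  push Not at h
  have := Real.sin_sq_add_cos_sq θ
  rw [h.1, h.2] at this
  norm_num at this

theorem ae_halfPlane_ne (x : ℝ × ℝ) (θ : ℝ) :
    ∀ᵐ z : ℝ × ℝ, Real.cos θ * (z.1 - x.1) + Real.sin θ * (z.2 - x.2) ≠ 0 := by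
  rw [ae_iff]
  have := volume_line_eq_zero (cos_ne_or_sin_ne θ) (Real.cos θ * x.1 + Real.sin θ * x.2)
  convert this using 2
  ext z
  simp only [ne_eq, not_not, Set.mem_ofPred_eq]
  constructor <;> intro h <;> linarith

theorem notMem_interior_halfPlane (x : ℝ × ℝ) (θ : ℝ) : x ∉ interior (halfPlane x θ) := by
  intro h
  have hc : Filter.Tendsto (fun t : ℝ => x + t • (Real.cos θ, Real.sin θ)) (nhds 0) (nhds x) := by
    have : Continuous (fun t : ℝ => x + t • (Real.cos θ, Real.sin θ)) := by fun_prop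
    simpa using this.tendsto 0
  have h1 := hc.eventually (isOpen_interior.mem_nhds h)
  have h2 : ∃ᶠ t : ℝ in nhds 0, t < 0 := by
    have : ∀ᶠ t : ℝ in nhdsWithin 0 (Set.Iio 0), t < 0 := self_mem_nhdsWithin
    exact this.frequently.filter_mono nhdsWithin_le_nhds
  obtain ⟨t, ht, ht'⟩ := (h2.and_eventually h1).exists
  have h3 : x + t • (Real.cos θ, Real.sin θ) ∈ halfPlane x θ := interior_subset ht'
  have h3 : 0 ≤ Real.cos θ * ((x + t • (Real.cos θ, Real.sin θ)).1 - x.1) +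
    Real.sin θ * ((x + t • (Real.cos θ, Real.sin θ)).2 - x.2) := h3
  simp at h3
  nlinarith [Real.sin_sq_add_cos_sq θ]

/-- Integrals over opposite half-planes add up. -/
theorem setIntegral_halfPlane_add {K : Set (ℝ × ℝ)} {G : ℝ × ℝ → ℝ}
    (hG : IntegrableOn G K) (x : ℝ × ℝ) (θ : ℝ) :
    (∫ z in K ∩ halfPlane x θ, G z) + ∫ z in K ∩ halfPlane x (θ + Real.pi), G z =
      ∫ z in K, G z := by
  have hm := (isClosed_halfPlane x θ).measurableSet
  have hm' := (isClosed_halfPlane x (θ + Real.pi)).measurableSet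
  rw [← integral_inter_add_sdiff (s := K) (t := halfPlane x θ) hm hG]
  congr 1
  apply setIntegral_congr_set
  filter_upwards [ae_halfPlane_ne x θ] with z hz
  apply propext
  show z ∈ K ∩ halfPlane x (θ + Real.pi) ↔ z ∈ K \ halfPlane x θ
  simp only [Set.mem_inter_iff, Set.mem_sdiff, halfPlane, Set.mem_ofPred_eq, Real.cos_add_pi,
    Real.sin_add_pi]
  refine and_congr_right fun _ => ?_
  constructor
  · intro h h'
    exact hz (le_antisymm (by linarith) h')
  · intro h; linarith

theorem continuous_setIntegral_halfPlane {K : Set (ℝ × ℝ)} {G : ℝ × ℝ → ℝ}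
    (hG : IntegrableOn G K) (x : ℝ × ℝ) : Continuous fun θ => ∫ z in K ∩ halfPlane x θ, G z := by
  have : (fun θ => ∫ z in K ∩ halfPlane x θ, G z) =
      fun θ => ∫ z in K, (halfPlane x θ).indicator G z := by
    ext θ
    rw [setIntegral_indicator (isClosed_halfPlane x θ).measurableSet]
  rw [this, continuous_iff_continuousAt]
  intro θ0
  refine continuousAt_of_dominated (bound := fun z => ‖G z‖) ?_ ?_ hG.norm ?_
  · exact Filter.Eventually.of_forall fun θ =>
      hG.aestronglyMeasurable.indicator (isClosed_halfPlane x θ).measurableSet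
  · exact Filter.Eventually.of_forall fun θ => Filter.Eventually.of_forall fun z =>
      norm_indicator_le_norm_self _ _
  · filter_upwards [ae_restrict_of_ae (ae_halfPlane_ne x θ0)] with z hz
    have hcont : Continuous fun θ => Real.cos θ * (z.1 - x.1) + Real.sin θ * (z.2 - x.2) := by
      fun_prop
    rcases lt_or_gt_of_ne hz with h | h
    · have := hcont.continuousAt.eventually (gt_mem_nhds h)
      refine (continuousAt_const (y := (0:ℝ))).congr ?_
      filter_upwards [this] with θ hθ
      rw [Set.indicator_of_notMem]
      exact fun h' => absurd h' (not_le.2 hθ)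
    · have := hcont.continuousAt.eventually (lt_mem_nhds h)
      refine (continuousAt_const (y := G z)).congr ?_
      filter_upwards [this] with θ hθ
      rw [Set.indicator_of_mem]
      exact hθ.le

/-- One bisection step: a compact convex set on which two functions have positive integral can be
cut by a line through a given point keeping both integrals positive. -/
theorem exists_bisection {G : Bool → ℝ × ℝ → ℝ} (hG : ∀ i, Continuous (G i)) {K : Set (ℝ × ℝ)}
    (hK : IsCompact K) (hc : Convex ℝ K) (hpos : ∀ i, 0 < ∫ z in K, G i z) (x : ℝ × ℝ) :
    ∃ K' ⊆ K, IsCompact K' ∧ Convex ℝ K' ∧ (∀ i, 0 < ∫ z in K', G i z) ∧ x ∉ interior K' := by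
  have hint : ∀ i, IntegrableOn (G i) K := fun i => (hG i).continuousOn.integrableOn_compact hK
  have hadd := fun i θ => setIntegral_halfPlane_add (hint i) x θ
  have hcont := continuous_setIntegral_halfPlane (hint true) x
  obtain ⟨θ, hθ⟩ : ∃ θ, ∫ z in K ∩ halfPlane x θ, G true z = (∫ z in K, G true z) / 2 := by
    have h0 := hadd true 0
    rcases le_total (∫ z in K ∩ halfPlane x 0, G true z) ((∫ z in K, G true z) / 2) with h | h
    · exact mem_range_of_exists_le_of_exists_ge hcont ⟨0, h⟩ ⟨0 + Real.pi, by linarith⟩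
    · exact mem_range_of_exists_le_of_exists_ge hcont ⟨0 + Real.pi, by linarith⟩ ⟨0, h⟩
  have hgood : ∀ φ, 0 < ∫ z in K ∩ halfPlane x φ, G true z →
      0 < ∫ z in K ∩ halfPlane x φ, G false z → 
      ∃ K' ⊆ K, IsCompact K' ∧ Convex ℝ K' ∧ (∀ i, 0 < ∫ z in K', G i z) ∧ x ∉ interior K' := by
    intro φ h1 h2
    refine ⟨K ∩ halfPlane x φ, Set.inter_subset_left, hK.inter_right (isClosed_halfPlane x φ),
      hc.inter (convex_halfPlane x φ), fun i => by cases i <;> assumption, fun h => ?_⟩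
    exact notMem_interior_halfPlane x φ (interior_mono Set.inter_subset_right h)
  have hT := hpos true
  have hF := hpos false
  have a1 := hadd true θ
  have a2 := hadd false θ
  rcases lt_or_ge 0 (∫ z in K ∩ halfPlane x θ, G false z) with h | h
  · exact hgood θ (by linarith) h
  · exact hgood (θ + Real.pi) (by linarith) (by linarith)

/-- Two-dimensional localization. -/
theorem hasNeedle_of_integral_pos {g : Bool → ℝ × ℝ → ℝ} (hg : ∀ i, Continuous (g i))
    {K : Set (ℝ × ℝ)} (hK : IsCompact K) (hc : Convex ℝ K) (hpos : ∀ i, 0 < ∫ z in K, g i z) :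
    HasNeedle K g := by
  have hsub : ∀ K : Set (ℝ × ℝ), IsCompact K → ∀ i κ,
      ∫ z in K, (g i z - κ) = (∫ z in K, g i z) - volume.real K * κ := by
    intro K hK i κ
    rw [integral_sub ((hg i).continuousOn.integrableOn_compact hK)
      (continuousOn_const.integrableOn_compact hK), setIntegral_const, smul_eq_mul]
  obtain ⟨κ, hκ1, hκ0⟩ : ∃ κ : ℝ, (∀ i, 0 < ∫ z in K, (g i z - κ)) ∧ 0 < κ := by
    have : ∀ i, ∀ᶠ κ in nhdsWithin (0:ℝ) (Set.Ioi 0), 0 < ∫ z in K, (g i z - κ) := by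
      intro i
      simp_rw [hsub K hK i]
      have hcont : Continuous fun κ : ℝ => (∫ z in K, g i z) - volume.real K * κ := by fun_prop
      exact nhdsWithin_le_nhds (hcont.continuousAt.eventually (lt_mem_nhds (by simpa using hpos i)))
    exact ((Filter.eventually_all.2 this).and self_mem_nhdsWithin).exists
  let Good : Set (ℝ × ℝ) → Prop := fun K =>
    IsCompact K ∧ Convex ℝ K ∧ ∀ i, 0 < ∫ z in K, (g i z - κ)
  have step : ∀ (x : ℝ × ℝ) (L : {L // Good L}), ∃ L' : {L // Good L},
      L'.1 ⊆ L.1 ∧ x ∉ interior L'.1 := by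
    rintro x ⟨L, h1, h2, h3⟩
    obtain ⟨L', h4, h5, h6, h7, h8⟩ := exists_bisection (G := fun i z => g i z - κ)
      (fun i => (hg i).sub continuous_const) h1 h2 h3 x
    exact ⟨⟨L', h5, h6, h7⟩, h4, h8⟩
  choose next hnext1 hnext2 using step
  let x : ℕ → ℝ × ℝ := TopologicalSpace.denseSeq (ℝ × ℝ)
  let S : ℕ → {L // Good L} := fun j =>
    Nat.rec (⟨K, hK, hc, hκ1⟩ : {L // Good L}) (fun j L => next (x j) L) j
  have hS : ∀ j, S (j + 1) = next (x j) (S j) := fun j => rfl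
  have hanti : Antitone fun j => (S j).1 := antitone_nat_of_succ_le fun j => by
    rw [hS]; exact hnext1 _ _
  have hSK : ∀ j, (S j).1 ⊆ K := fun j => hanti (Nat.zero_le j)
  set T := ⋂ j, (S j).1 with hT
  have hTc : Convex ℝ T := convex_iInter fun j => (S j).2.2.1
  have hTi : ¬ (interior T).Nonempty := by
    intro h
    obtain ⟨j, hj⟩ := (TopologicalSpace.denseRange_denseSeq (ℝ × ℝ)).exists_mem_open
      isOpen_interior h
    have : T ⊆ (S (j + 1)).1 := Set.iInter_subset (fun j => (S j).1) (j + 1)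
    have h2 := interior_mono this hj
    rw [hS] at h2
    exact hnext2 _ _ h2
  have hline : ∃ u v c : ℝ, (u ≠ 0 ∨ v ≠ 0) ∧ ∀ z ∈ T, u * z.1 + v * z.2 = c := by
    rcases Set.eq_empty_or_nonempty T with h | ⟨z0, hz0⟩
    · exact ⟨1, 0, 0, Or.inl one_ne_zero, fun z hz => by rw [h] at hz; exact absurd hz (by simp)⟩
    have h1 : affineSpan ℝ T ≠ ⊤ := fun h => hTi (hTc.interior_nonempty_iff_affineSpan_eq_top.2 h)
    have hz0' := subset_affineSpan ℝ T hz0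
    have h2 : (affineSpan ℝ T).direction ≠ ⊤ := fun h =>
      h1 ((AffineSubspace.direction_eq_top_iff_of_nonempty ⟨z0, hz0'⟩).1 h)
    obtain ⟨f, hf0, hf⟩ := Submodule.exists_le_ker_of_lt_top _ (lt_top_iff_ne_top.2 h2)
    have hfz : ∀ z : ℝ × ℝ, f z = f (1, 0) * z.1 + f (0, 1) * z.2 := by
      intro z
      have : z = z.1 • (1, 0) + z.2 • (0, 1) := by ext <;> simp
      conv_lhs => rw [this]
      rw [map_add, map_smul, map_smul, smul_eq_mul, smul_eq_mul]; ring
    refine ⟨f (1, 0), f (0, 1), f z0, ?_, ?_⟩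
    · by_contra h
      push Not at h
      apply hf0
      ext <;> simp [h.1, h.2]
    · intro z hz
      rw [← hfz]
      have := hf (AffineSubspace.vsub_mem_direction (subset_affineSpan ℝ T hz) hz0')
      rw [LinearMap.mem_ker, vsub_eq_sub, map_sub, sub_eq_zero] at this
      exact this
  obtain ⟨u, v, c, huv, hTl⟩ := hline
  obtain ⟨δ, hδ, H⟩ := exists_hasNeedle_of_near_hyperplane hK hg hκ0 huv c
  obtain ⟨j, hj⟩ := exists_subset_nhds_of_isCompact (V := fun j => (S j).1)
    (hanti.directed_ge) (fun j => (S j).2.1) (U := {z | |u * z.1 + v * z.2 - c| < δ}) (by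
      intro z hz
      refine (isOpen_lt (by fun_prop) continuous_const).mem_nhds ?_
      show |u * z.1 + v * z.2 - c| < δ
      rw [hTl z hz]; simpa using hδ)
  have hGj := (S j).2
  refine (H _ (hSK j) hGj.1 hGj.2.1 ?_ (fun i => (hGj.2.2 i).le) (fun z hz => hj hz)).mono (hSK j)
  rw [measureReal_def, ENNReal.toReal_pos_iff]
  refine ⟨?_, hGj.1.measure_lt_top⟩
  by_contra h
  have h0 : volume (S j).1 = 0 := by simpa using h
  have := hGj.2.2 true
  rw [setIntegral_measure_zero _ h0] at this
  exact lt_irrefl _ this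

theorem LogConcaveOn.concaveOn_mul {E : Type*} [AddCommGroup E] [Module ℝ E] {s : Set E}
    {h p : E → ℝ} (hh : ∀ x ∈ s, ∀ y ∈ s, ∀ l : ℝ, 0 ≤ l → l ≤ 1 →
      (1 - l) * h x + l * h y ≤ h ((1 - l) • x + l • y)) (hh0 : ∀ x, 0 ≤ h x)
    (hp0 : ∀ x, 0 ≤ p x) (hp : LogConcaveOn s p) : LogConcaveOn s fun x => h x * p x := by
  intro x hx y hy l hl0 hl1
  simp only
  rw [Real.mul_rpow (hh0 x) (hp0 x), Real.mul_rpow (hh0 y) (hp0 y)]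
  have h1 := Real.geom_mean_le_arith_mean2_weighted (sub_nonneg.2 hl1) hl0 (hh0 x) (hh0 y) (by ring)
  have h2 := h1.trans (hh x hx y hy l hl0 hl1)
  have h3 := hp x hx y hy l hl0 hl1
  calc h x ^ (1 - l) * p x ^ (1 - l) * (h y ^ l * p y ^ l)
      = (h x ^ (1 - l) * h y ^ l) * (p x ^ (1 - l) * p y ^ l) := by ring
    _ ≤ _ := mul_le_mul h2 h3 (mul_nonneg (Real.rpow_nonneg (hp0 _) _) (Real.rpow_nonneg (hp0 _) _))
        (hh0 _)

/-- Lebesgue measure on a cube. -/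
noncomputable abbrev cubeMeasure (α β : ℝ) (n : ℕ) : Measure (Fin n → ℝ) :=
  Measure.pi fun _ => volume.restrict (Set.Icc α β)

theorem cubeMeasure_eq (α β : ℝ) (n : ℕ) : cubeMeasure α β n =
    (volume : Measure (Fin n → ℝ)).restrict (Set.univ.pi fun _ => Set.Icc α β) := by
  rw [volume_pi, Measure.restrict_pi_pi]

theorem isCompact_cube (α β : ℝ) (n : ℕ) :
    IsCompact (Set.univ.pi fun _ : Fin n => Set.Icc α β) :=
  isCompact_univ_pi fun _ => isCompact_Icc

theorem Continuous.integrable_prod_cubeMeasure {α β : ℝ} {n : ℕ} {X : Type*} [TopologicalSpace X]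
    [MeasurableSpace X] [BorelSpace X] [T2Space X] [SecondCountableTopology X] {μ : Measure X}
    [SFinite μ] [IsFiniteMeasureOnCompacts μ] {K : Set X} (hK : IsCompact K)
    {F : X × (Fin n → ℝ) → ℝ} (hF : Continuous F) :
    Integrable F ((μ.restrict K).prod (cubeMeasure α β n)) := by
  rw [cubeMeasure_eq, Measure.prod_restrict]
  have hc := hK.prod (isCompact_cube α β n)
  refine hF.continuousOn.integrableOn_of_subset_isCompact hc hc.measurableSet subset_rfl ?_
  rw [Measure.prod_prod]
  exact (ENNReal.mul_lt_top hK.measure_lt_top (isCompact_cube α β n).measure_lt_top).ne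

theorem continuous_integral_cubeMeasure {α β : ℝ} {n : ℕ} {X : Type*} [TopologicalSpace X]
    [FirstCountableTopology X] [LocallyCompactSpace X]
    {F : X × (Fin n → ℝ) → ℝ} (hF : Continuous F) :
    Continuous fun x => ∫ u, F (x, u) ∂(cubeMeasure α β n) := by
  rw [cubeMeasure_eq]
  exact continuous_parametric_integral_of_continuous (f := fun x u => F (x, u)) hF
    (isCompact_cube α β n)

/-- Splitting off one more coordinate. -/
def splitCoord (n : ℕ) (z : (ℝ × ℝ) × (Fin n → ℝ)) : ℝ × (Fin (n + 1) → ℝ) :=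
  (z.1.1, Fin.cons z.1.2 z.2)

theorem continuous_splitCoord (n : ℕ) : Continuous (splitCoord n) := by
  unfold splitCoord
  refine (continuous_fst.comp continuous_fst).prodMk (continuous_pi fun i => ?_)
  refine Fin.cases ?_ (fun j => ?_) i
  · simp only [Fin.cons_zero]; fun_prop
  · simp only [Fin.cons_succ]; fun_prop

theorem integral_splitCoord (α β a b : ℝ) (n : ℕ) (F : ℝ × (Fin (n + 1) → ℝ) → ℝ) :
    ∫ z, F (splitCoord n z) ∂(((volume : Measure (ℝ × ℝ)).restrict
      (Set.Icc a b ×ˢ Set.Icc α β)).prod (cubeMeasure α β n)) =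
    ∫ z, F z ∂((volume.restrict (Set.Icc a b)).prod (cubeMeasure α β (n + 1))) := by
  have h1 := (measurePreserving_piFinSuccAbove
    (fun _ : Fin (n + 1) => volume.restrict (Set.Icc α β)) 0).symm
  have h2 := (MeasurePreserving.id (volume.restrict (Set.Icc a b))).prod h1
  have h3 := measurePreserving_prodAssoc (volume.restrict (Set.Icc a b))
    (volume.restrict (Set.Icc α β)) (cubeMeasure α β n)
  have h4 := h2.comp h3
  have e : ((volume : Measure (ℝ × ℝ)).restrict (Set.Icc a b ×ˢ Set.Icc α β)) =
      (volume.restrict (Set.Icc a b)).prod (volume.restrict (Set.Icc α β)) := by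
    rw [Measure.prod_restrict, Measure.volume_eq_prod]
  rw [e]
  let Φ : (ℝ × ℝ) × (Fin n → ℝ) ≃ᵐ ℝ × (Fin (n + 1) → ℝ) :=
    MeasurableEquiv.prodAssoc.trans ((MeasurableEquiv.refl ℝ).prodCongr
      (MeasurableEquiv.piFinSuccAbove (fun _ => ℝ) 0).symm)
  have h5 : MeasurePreserving Φ
    (((volume.restrict (Set.Icc a b)).prod (volume.restrict (Set.Icc α β))).prod
      (cubeMeasure α β n))
    ((volume.restrict (Set.Icc a b)).prod (cubeMeasure α β (n + 1))) := h4
  rw [← h5.integral_comp']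
  refine integral_congr_ae (.of_forall fun z => congrArg F (Prod.ext rfl (funext fun i => ?_)))
  refine Fin.cases ?_ (fun j => ?_) i
  · simp [Φ, splitCoord, MeasurableEquiv.piFinSuccAbove]; rfl
  · simp [Φ, splitCoord, MeasurableEquiv.piFinSuccAbove]; rfl

theorem splitCoord_combo (n : ℕ) (z z' : (ℝ × ℝ) × (Fin n → ℝ)) (s t : ℝ) :
    splitCoord n (s • z + t • z') = s • splitCoord n z + t • splitCoord n z' := by
  unfold splitCoord
  refine Prod.ext (by simp) (funext fun i => ?_)
  refine Fin.cases ?_ (fun j => ?_) i <;> simp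

/-- Localization of two integral inequalities on a box with a log-concave weight to a
one-dimensional log-concave weight. -/
theorem exists_localization (α β : ℝ) (n : ℕ) : ∀ (a b : ℝ) (p : ℝ × (Fin n → ℝ) → ℝ),
    Continuous p → (∀ z, 0 ≤ p z) →
    LogConcaveOn (Set.Icc a b ×ˢ Set.univ.pi fun _ => Set.Icc α β) p →
    ∀ g : Bool → ℝ × (Fin n → ℝ) → ℝ, (∀ i, Continuous (g i)) →
    (∀ i, 0 < ∫ z, g i z * p z ∂((volume.restrict (Set.Icc a b)).prod (cubeMeasure α β n))) →
    ∃ (a' b' : ℝ) (c v : ℝ × (Fin n → ℝ)) (w : ℝ → ℝ), Continuous w ∧ (∀ t, 0 ≤ w t) ∧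
      LogConcaveOn (Set.Icc a' b') w ∧ ∀ i, 0 < ∫ t in Set.Icc a' b', g i (c + t • v) * w t := by
  induction n with
  | zero =>
    intro a b p hp hp0 hlc g hg hpos
    refine ⟨a, b, (0, 0), (1, 0), fun t => p (t, 0), by fun_prop, fun t => hp0 _, ?_, ?_⟩
    · intro x hx y hy l hl0 hl1
      have := hlc (x, 0) ⟨hx, by simp⟩ (y, 0) ⟨hy, by simp⟩ l hl0 hl1
      simpa using this
    · intro i
      have := hpos i
      rw [cubeMeasure, Measure.pi_of_empty _ 0, Measure.prod_dirac,
        integral_map (by fun_prop) (by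
          have := hg i; exact Continuous.aestronglyMeasurable (by fun_prop))] at this
      simpa using this
  | succ n ih =>
    intro a b p hp hp0 hlc g hg hpos
    have hF : ∀ i, Continuous fun z => g i (splitCoord n z) * p (splitCoord n z) := fun i => by
      have := hg i; have := continuous_splitCoord n; fun_prop
    set G : Bool → ℝ × ℝ → ℝ := fun i q =>
      ∫ u, g i (splitCoord n (q, u)) * p (splitCoord n (q, u)) ∂(cubeMeasure α β n) with hG
    have hGc : ∀ i, Continuous (G i) := fun i => continuous_integral_cubeMeasure (hF i)
    have hQ : IsCompact (Set.Icc a b ×ˢ Set.Icc α β) := isCompact_Icc.prod isCompact_Icc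
    have hGpos : ∀ i, 0 < ∫ q in Set.Icc a b ×ˢ Set.Icc α β, G i q := by
      intro i
      have h1 := hpos i
      rw [← integral_splitCoord α β a b n (fun z => g i z * p z),
        integral_prod _ (Continuous.integrable_prod_cubeMeasure hQ (hF i))] at h1
      exact h1
    obtain ⟨a1, b1, c1, v1, h, hhc, hh0, hhconc, hmem, hneedle⟩ := hasNeedle_of_integral_pos hGc hQ
      ((convex_Icc a b).prod (convex_Icc α β)) hGpos
    let A : ℝ × (Fin n → ℝ) → ℝ × (Fin (n + 1) → ℝ) := fun z =>
      splitCoord n (c1 + z.1 • v1, z.2)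
    have hA : Continuous A := (continuous_splitCoord n).comp (by fun_prop)
    have hAcombo : ∀ z z' : ℝ × (Fin n → ℝ), ∀ l : ℝ,
        A ((1 - l) • z + l • z') = (1 - l) • A z + l • A z' := by
      intro z z' l
      simp only [A]
      rw [← splitCoord_combo]
      congr 1
      refine Prod.ext (Prod.ext ?_ ?_) rfl <;> simp <;> ring
    obtain ⟨a2, b2, c2, v2, w, hw, hw0, hwlc, hfin⟩ := ih a1 b1 (fun z => h z.1 * p (A z))
      (by fun_prop) (fun z => mul_nonneg (hh0 _) (hp0 _)) (by
        apply LogConcaveOn.concaveOn_mul (h := fun z : ℝ × (Fin n → ℝ) => h z.1) _ (fun z => hh0 _)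
          (fun z => hp0 _)
        · intro x hx y hy l hl0 hl1
          have hAm : ∀ z ∈ Set.Icc a1 b1 ×ˢ (Set.univ.pi fun _ : Fin n => Set.Icc α β),
              A z ∈ Set.Icc a b ×ˢ (Set.univ.pi fun _ : Fin (n + 1) => Set.Icc α β) := by
            intro z hz
            have h1 := hmem z.1 hz.1
            refine ⟨h1.1, fun i _ => ?_⟩
            refine Fin.cases ?_ (fun j => ?_) i
            · exact h1.2
            · exact hz.2 j (Set.mem_univ _)
          have := hlc (A x) (hAm x hx) (A y) (hAm y hy) l hl0 hl1
          rw [← hAcombo] at this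
          exact this
        · intro x hx y hy l hl0 hl1
          have := hhconc.2 hx.1 hy.1 (sub_nonneg.2 hl1) hl0 (by ring)
          simpa using this)
      (fun i z => g i (A z)) (fun i => (hg i).comp hA) (by
        intro i
        rw [integral_prod _ (Continuous.integrable_prod_cubeMeasure isCompact_Icc (by
          have := hg i; fun_prop))]
        refine (hneedle i).trans_eq (integral_congr_ae (Filter.Eventually.of_forall fun t => ?_))
        simp only [hG]
        rw [mul_comm, ← integral_const_mul]
        refine integral_congr_ae (Filter.Eventually.of_forall fun u => ?_)
        simp only [A]
        ring)
    refine ⟨a2, b2, A c2, A v2 - A 0, w, hw, hw0, hwlc, fun i => ?_⟩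
    have hlin : ∀ t : ℝ, A (c2 + t • v2) = A c2 + t • (A v2 - A 0) := by
      intro t
      simp only [A, splitCoord]
      refine Prod.ext ?_ (funext fun i => ?_)
      · simp; ring
      · refine Fin.cases ?_ (fun j => ?_) i
        · simp; ring
        · simp
    have := hfin i
    simp_rw [hlin] at this
    exact this

/-- A Pólya-type estimate: a product of distances to `k` points is rarely much smaller
than `1` under a measure of bounded density. -/
theorem measure_prod_norm_sub_le_of_le_smul {η : Measure ℝ} {M : ℝ} (hM : 0 < M)
    (hη : η ≤ ENNReal.ofReal M • volume) {k : ℕ} (hk : 0 < k) (ζ : Fin k → ℂ) {r : ℝ}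
    (hr : 0 < r) :
    η {s | ∏ j, ‖(s : ℂ) - ζ j‖ ≤ r ^ k} ≤ ENNReal.ofReal (6 * M * r) := by
  have he : Real.exp 1 ≤ 3 := by linarith [Real.exp_one_lt_d9]
  have hac : η ≪ volume := (Measure.absolutelyContinuous_of_le hη).trans
    (Measure.AbsolutelyContinuous.rfl.smul_left _)
  have hne : ∀ᵐ s : ℝ ∂η, ∀ j, s ≠ (ζ j).re := by
    apply hac.ae_le
    refine ae_all_iff.2 fun j => ?_
    simp [ae_iff]
  set g : ℝ → ENNReal := fun s => ∑ j, ENNReal.ofReal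
    (Real.posLog (Real.exp 1 * r / |s - (ζ j).re|)) with hg
  have hgm : Measurable g := by
    apply Finset.measurable_fun_sum; intro j _; fun_prop
  have hsub : {s : ℝ | ∏ j, ‖(s : ℂ) - ζ j‖ ≤ r ^ k} ≤ᵐ[η] {s | (k : ENNReal) ≤ g s} := by
    filter_upwards [hne] with s hs hs2
    have hs2 : ∏ j, ‖(s : ℂ) - ζ j‖ ≤ r ^ k := hs2
    have hpos : ∀ j, 0 < |s - (ζ j).re| := fun j => abs_pos.2 (sub_ne_zero.2 (hs j))
    have hle : ∀ j, |s - (ζ j).re| ≤ ‖(s : ℂ) - ζ j‖ := fun j => by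
      have := Complex.abs_re_le_norm ((s : ℂ) - ζ j)
      simpa using this
    have hpp := Finset.prod_pos fun j (_ : j ∈ Finset.univ) => hpos j
    have hs3 : ∏ j, |s - (ζ j).re| ≤ r ^ k :=
      (Finset.prod_le_prod (fun j _ => (hpos j).le) fun j _ => hle j).trans hs2
    change (k : ENNReal) ≤ g s
    rw [hg]
    simp only
    rw [← ENNReal.ofReal_sum_of_nonneg (fun j _ => Real.posLog_nonneg), ← ENNReal.ofReal_natCast]
    apply ENNReal.ofReal_le_ofReal
    have h1 : ∑ j, Real.log (Real.exp 1 * r / |s - (ζ j).re|) ≤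
        ∑ j, Real.posLog (Real.exp 1 * r / |s - (ζ j).re|) :=
      Finset.sum_le_sum fun j _ => le_max_right _ _
    refine le_trans ?_ h1
    have h2 : ∀ j, Real.log (Real.exp 1 * r / |s - (ζ j).re|) =
        1 + Real.log r - Real.log |s - (ζ j).re| := by
      intro j
      rw [Real.log_div (by positivity) (hpos j).ne', Real.log_mul (by positivity) hr.ne',
        Real.log_exp]
    simp_rw [h2]
    rw [Finset.sum_sub_distrib, ← Real.log_prod (fun j _ => (hpos j).ne')]
    simp only [Finset.sum_const, Finset.card_univ, Fintype.card_fin, nsmul_eq_mul]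
    have h3 := Real.log_le_log hpp hs3
    rw [Real.log_pow] at h3
    linarith
  refine (measure_mono_ae hsub).trans ?_
  have hk' : (k : ENNReal) ≠ 0 := by exact_mod_cast hk.ne'
  refine (meas_ge_le_lintegral_div hgm.aemeasurable hk' (ENNReal.natCast_ne_top k)).trans ?_
  rw [ENNReal.div_le_iff hk' (ENNReal.natCast_ne_top k)]
  refine (lintegral_mono' hη le_rfl).trans ?_
  rw [lintegral_smul_measure, hg, lintegral_finsetSum _ (fun j _ => by fun_prop)]
  refine (mul_le_mul_right (Finset.sum_le_sum fun j _ => lintegral_posLog_div_abs_sub_le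
    (Real.exp 1 * r) (by positivity) (ζ j).re) _).trans ?_
  simp only [Finset.sum_const, Finset.card_univ, Fintype.card_fin, nsmul_eq_mul]
  rw [mul_left_comm, mul_comm, ← ENNReal.ofReal_mul hM.le]
  exact mul_le_mul' (ENNReal.ofReal_le_ofReal (by nlinarith [mul_pos hM hr])) le_rfl

/-- Lower bound for the second moment of a monic polynomial under a probability measure of
bounded density. -/
theorem Polynomial.Monic.pow_le_integral_eval_sq {η : Measure ℝ} [IsProbabilityMeasure η] {M : ℝ}
    (hM : 1 ≤ M) (hη : η ≤ ENNReal.ofReal M • volume)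
    {P : Polynomial ℝ} (hP : P.Monic) (hint : Integrable (fun s => P.eval s ^ 2) η) :
    (1 / (288 * M ^ 2)) ^ P.natDegree ≤ ∫ s, P.eval s ^ 2 ∂η := by
  have hM0 : 0 < M := by linarith
  rcases Nat.eq_zero_or_pos P.natDegree with h0 | hk
  · have : P = 1 := hP.natDegree_eq_zero.1 h0
    subst this
    simp
  have hroots := P.abs_eval_eq_prod_norm_sub
  set k := P.natDegree
  obtain ⟨ζ, hζ⟩ := hroots
  set r := 1 / (12 * M) with hr
  have hr0 : 0 < r := by positivity
  have h1 := measure_prod_norm_sub_le_of_le_smul hM0 hη hk ζ hr0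
  have h2 : 6 * M * r = 1 / 2 := by rw [hr]; field_simp; norm_num
  rw [h2] at h1
  set S := {s : ℝ | r ^ (2 * k) < P.eval s ^ 2} with hS
  have hSm : MeasurableSet S := measurableSet_lt measurable_const (by fun_prop)
  have hSc : Sᶜ ⊆ {s : ℝ | ∏ j, ‖(s : ℂ) - ζ j‖ ≤ r ^ k} := by
    intro s hs
    have hs : P.eval s ^ 2 ≤ r ^ (2 * k) := not_lt.1 hs
    have h3 := hζ s
    rw [hP.leadingCoeff, abs_one, one_mul] at h3
    change ∏ j, ‖(s : ℂ) - ζ j‖ ≤ r ^ k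
    rw [← h3]
    rw [mul_comm, pow_mul] at hs
    exact abs_le_of_sq_le_sq hs (pow_nonneg hr0.le k)
  have h4 : η.real Sᶜ ≤ 1 / 2 := by
    have := (measure_mono hSc).trans h1
    exact ENNReal.toReal_le_of_le_ofReal (by norm_num) this
  have h5 : 1 / 2 ≤ η.real S := by
    have := measureReal_add_measureReal_compl (μ := η) hSm
    rw [probReal_univ] at this
    linarith
  have h6 : r ^ (2 * k) * η.real S ≤ ∫ s, P.eval s ^ 2 ∂η := by
    calc r ^ (2 * k) * η.real S = ∫ s in S, r ^ (2 * k) ∂η := by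
          rw [setIntegral_const, smul_eq_mul, mul_comm]
      _ ≤ ∫ s in S, P.eval s ^ 2 ∂η := setIntegral_mono_on (by simp) hint.integrableOn hSm
          fun s hs => le_of_lt hs
      _ ≤ _ := setIntegral_le_integral hint (.of_forall fun s => sq_nonneg _)
  refine le_trans ?_ h6
  calc (1 / (288 * M ^ 2)) ^ k = (r ^ 2) ^ k * (1 / 2) ^ k := by
        rw [← mul_pow, hr]; congr 1; field_simp; norm_num
    _ ≤ (r ^ 2) ^ k * (1 / 2) := by
        gcongr
        exact pow_le_of_le_one (by norm_num) (by norm_num) hk.ne'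
    _ = r ^ (2 * k) * (1 / 2) := by rw [← pow_mul]
    _ ≤ _ := by gcongr

/-- Existence of monic orthogonal polynomials. -/
theorem exists_monic_orthogonal {η : Measure ℝ}
    (hint : ∀ P : Polynomial ℝ, Integrable (fun s => P.eval s) η)
    (hpos : ∀ P : Polynomial ℝ, P.Monic → 0 < ∫ s, P.eval s ^ 2 ∂η) (k : ℕ) :
    ∃ P : Polynomial ℝ, P.Monic ∧ P.natDegree = k ∧
      ∀ Q : Polynomial ℝ, Q.degree < k → ∫ s, Q.eval s * P.eval s ∂η = 0 := by
  classical
  have hint2 : ∀ P Q : Polynomial ℝ, Integrable (fun s => P.eval s * Q.eval s) η := fun P Q => by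
    simpa using hint (P * Q)
  let V := Polynomial.degreeLT ℝ k
  let B : Polynomial ℝ →ₗ[ℝ] Polynomial ℝ →ₗ[ℝ] ℝ := LinearMap.mk₂ ℝ
    (fun P Q => ∫ s, P.eval s * Q.eval s ∂η)
    (fun P P' Q => by
      simp only [Polynomial.eval_add, add_mul]
      exact integral_add (hint2 _ _) (hint2 _ _))
    (fun c P Q => by
      simp only [Polynomial.eval_smul, smul_eq_mul, mul_assoc]
      exact integral_const_mul _ _)
    (fun P Q Q' => by
      simp only [Polynomial.eval_add, mul_add]
      exact integral_add (hint2 _ _) (hint2 _ _))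
    (fun c P Q => by
      simp only [Polynomial.eval_smul, smul_eq_mul, mul_left_comm]
      exact integral_const_mul _ _)
  have hB : ∀ P Q, B P Q = ∫ s, P.eval s * Q.eval s ∂η := fun P Q => rfl
  have hdef : ∀ P, B P P = 0 → P = 0 := by
    intro P hP
    by_contra hne
    have hl : P.leadingCoeff ≠ 0 := Polynomial.leadingCoeff_ne_zero.2 hne
    have h1 := hpos (Polynomial.C P.leadingCoeff⁻¹ * P)
      (Polynomial.monic_C_mul_of_mul_leadingCoeff_eq_one (inv_mul_cancel₀ hl))
    have h2 : ∫ s, (Polynomial.C P.leadingCoeff⁻¹ * P).eval s ^ 2 ∂η =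
        P.leadingCoeff⁻¹ ^ 2 * B P P := by
      rw [hB, ← integral_const_mul]
      refine integral_congr_ae (.of_forall fun s => ?_)
      simp only [Polynomial.eval_mul, Polynomial.eval_C]
      ring
    rw [h2, hP] at h1
    simp at h1
  let T : V →ₗ[ℝ] Module.Dual ℝ V := B.domRestrict₁₂ V V
  have hT : Function.Injective T := by
    rw [injective_iff_map_eq_zero]
    intro R hR
    have : B R R = 0 := by
      have := LinearMap.congr_fun hR R
      exact this
    exact Subtype.ext (hdef _ this)
  have : FiniteDimensional ℝ V := (Polynomial.degreeLTEquiv ℝ k).symm.finiteDimensional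
  have hTs : Function.Surjective T :=
    (LinearMap.injective_iff_surjective_of_finrank_eq_finrank Subspace.dual_finrank_eq.symm).1 hT
  obtain ⟨R, hR⟩ := hTs ((B (Polynomial.X ^ k)).domRestrict V)
  have hRd : (R : Polynomial ℝ).degree < k := Polynomial.mem_degreeLT.1 R.2
  have hXk : (Polynomial.X ^ k : Polynomial ℝ).degree = k := Polynomial.degree_X_pow k
  refine ⟨Polynomial.X ^ k - (R : Polynomial ℝ), (Polynomial.monic_X_pow k).sub_of_left
    (by rwa [hXk]), ?_, ?_⟩
  · apply Polynomial.natDegree_eq_of_degree_eq_some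
    rw [Polynomial.degree_sub_eq_left_of_degree_lt (by rwa [hXk]), hXk]
  · intro Q hQ
    have h1 := LinearMap.congr_fun hR ⟨Q, Polynomial.mem_degreeLT.2 hQ⟩
    have h2 : B R Q = B (Polynomial.X ^ k) Q := by exact h1
    have h3 : B (Polynomial.X ^ k - (R : Polynomial ℝ)) Q = 0 := by
      rw [map_sub, LinearMap.sub_apply, h2, sub_self]
    rw [hB] at h3
    rw [← h3]
    exact integral_congr_ae (.of_forall fun s => mul_comm _ _)

/-- Lower bound of the second moment of a polynomial under a product measure in terms of its top
level content. -/
theorem pow_mul_coeffd_sq_le_integral {η : Measure ℝ} [IsProbabilityMeasure η] {c : ℝ}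
    (hc : 0 < c) (hint : ∀ P : Polynomial ℝ, Integrable (fun s => P.eval s) η)
    (hlow : ∀ P : Polynomial ℝ, P.Monic → c ^ P.natDegree ≤ ∫ s, P.eval s ^ 2 ∂η)
    {n d : ℕ} {f : MvPolynomial (Fin n) ℝ} (hf : f.totalDegree ≤ d) :
    c ^ d * (coeffd d f) ^ 2 ≤
      ∫ x, (MvPolynomial.eval x f) ^ 2 ∂(Measure.pi fun _ : Fin n => η) := by
  classical
  have hpos : ∀ P : Polynomial ℝ, P.Monic → 0 < ∫ s, P.eval s ^ 2 ∂η := fun P hP =>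
    lt_of_lt_of_le (by positivity) (hlow P hP)
  choose π hπm hπd hπo using exists_monic_orthogonal hint hpos
  set μ := Measure.pi fun _ : Fin n => η with hμ
  set κ : ℕ → ℝ := fun k => ∫ s, (π k).eval s ^ 2 ∂η with hκ
  have hint2 : ∀ P Q : Polynomial ℝ, Integrable (fun s => P.eval s * Q.eval s) η := fun P Q => by
    simpa using hint (P * Q)
  have hXπ : ∀ k, ∫ s, s ^ k * (π k).eval s ∂η = κ k := by
    intro k
    have h1 : (Polynomial.X ^ k - π k).degree < (k : WithBot ℕ) := by
      have := Polynomial.degree_sub_lt_left (p := Polynomial.X ^ k) (q := π k)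
        (by rw [Polynomial.degree_X_pow, Polynomial.degree_eq_natDegree (hπm k).ne_zero, hπd])
        (by simp) (by rw [Polynomial.leadingCoeff_X_pow, (hπm k).leadingCoeff])
      rwa [Polynomial.degree_X_pow] at this
    have h2 := hπo k _ h1
    simp only [Polynomial.eval_sub, Polynomial.eval_pow, Polynomial.eval_X, sub_mul] at h2
    rw [integral_sub (by simpa using hint2 (Polynomial.X ^ k) (π k)) (hint2 _ _)] at h2
    rw [hκ]
    simp only [sq]
    linarith
  let S := f.support.filter (fun m => (∑ i, m i) = d)
  let H : (Fin n →₀ ℕ) → (Fin n → ℝ) → ℝ := fun m x => ∏ i, (π (m i)).eval (x i)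
  let T : (Fin n → ℝ) → ℝ := fun x => ∑ m ∈ S, f.coeff m * H m x
  let K : (Fin n →₀ ℕ) → ℝ := fun m => ∏ i, κ (m i)
  have hprodint : ∀ P Q : Fin n → Polynomial ℝ,
      Integrable (fun x => (∏ i, (P i).eval (x i)) * ∏ i, (Q i).eval (x i)) μ := by
    intro P Q
    simp only [← Finset.prod_mul_distrib]
    exact Integrable.fintype_prod (f := fun i s => (P i).eval s * (Q i).eval s)
      fun i => hint2 _ _
  have hprod : ∀ P Q : Fin n → Polynomial ℝ,
      ∫ x, (∏ i, (P i).eval (x i)) * ∏ i, (Q i).eval (x i) ∂μ =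
        ∏ i, ∫ s, (P i).eval s * (Q i).eval s ∂η := by
    intro P Q
    simp only [← Finset.prod_mul_distrib]
    exact integral_fintype_prod_eq_prod (fun i s => (P i).eval s * (Q i).eval s)
  have hlt : ∀ m m' : Fin n →₀ ℕ, (∑ i, m i) ≤ ∑ i, m' i → m ≠ m' → ∃ j, m j < m' j := by
    intro m m' h hne
    by_contra hcon
    push Not at hcon
    have := (Finset.sum_eq_sum_iff_of_le (s := Finset.univ) fun i _ => hcon i).1
      (le_antisymm (Finset.sum_le_sum fun i _ => hcon i) h)
    exact hne (Finsupp.ext fun i => (this i (Finset.mem_univ i)).symm)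
  have horth : ∀ (P : ℕ → Polynomial ℝ), (∀ k, (P k).degree = k) →
      (∀ k, ∫ s, (P k).eval s * (π k).eval s ∂η = κ k) → ∀ m m' : Fin n →₀ ℕ,
      (∑ i, m i) ≤ ∑ i, m' i →
      ∫ x, (∏ i, (P (m i)).eval (x i)) * H m' x ∂μ = if m = m' then K m' else 0 := by
    intro P hP hPκ m m' hle
    rw [hprod]
    split_ifs with h
    · subst h; exact Finset.prod_congr rfl fun i _ => hPκ _
    · obtain ⟨j, hj⟩ := hlt m m' hle h
      exact Finset.prod_eq_zero (Finset.mem_univ j) (hπo _ _ (by rw [hP]; exact_mod_cast hj))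
  have hSd : ∀ m ∈ S, ∑ i, m i = d := fun m hm => (Finset.mem_filter.1 hm).2
  have hfd : ∀ m ∈ f.support, ∑ i, m i ≤ d := fun m hm => by
    have := (MvPolynomial.le_totalDegree hm).trans hf
    rwa [Finsupp.sum_fintype _ _ (fun _ => rfl)] at this
  have hfx : ∀ x, MvPolynomial.eval x f = ∑ m ∈ f.support, f.coeff m *
      ∏ i, ((Polynomial.X : Polynomial ℝ) ^ (m i)).eval (x i) := fun x => by
    rw [MvPolynomial.eval_eq']; simp
  have hgen : ∀ (P : ℕ → Polynomial ℝ), (∀ k, (P k).degree = k) →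
      (∀ k, ∫ s, (P k).eval s * (π k).eval s ∂η = κ k) → ∀ R : Finset (Fin n →₀ ℕ), S ⊆ R →
      (∀ m ∈ R, ∑ i, m i ≤ d) →
      Integrable (fun x => (∑ m ∈ R, f.coeff m * ∏ i, (P (m i)).eval (x i)) * T x) μ ∧
      ∫ x, (∑ m ∈ R, f.coeff m * ∏ i, (P (m i)).eval (x i)) * T x ∂μ =
        ∑ m ∈ S, f.coeff m ^ 2 * K m := by
    intro P hP hPκ R hSR hR
    have e : ∀ x, (∑ m ∈ R, f.coeff m * ∏ i, (P (m i)).eval (x i)) * T x =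
        ∑ m ∈ R, ∑ m' ∈ S, f.coeff m * f.coeff m' *
          ((∏ i, (P (m i)).eval (x i)) * H m' x) := fun x => by
      rw [Finset.sum_mul_sum]
      exact Finset.sum_congr rfl fun m _ => Finset.sum_congr rfl fun m' _ => by ring
    simp_rw [e]
    have hi : ∀ m m', Integrable (fun x => f.coeff m * f.coeff m' *
          ((∏ i, (P (m i)).eval (x i)) * H m' x)) μ := fun m m' => (hprodint _ _).const_mul _
    refine ⟨integrable_finsetSum _ fun m _ => integrable_finsetSum _ fun m' _ => hi m m', ?_⟩
    rw [integral_finsetSum _ fun m _ => integrable_finsetSum _ fun m' _ => hi m m',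
      Finset.sum_congr rfl fun m _ => integral_finsetSum _ fun m' _ => hi m m',
      Finset.sum_comm]
    refine Finset.sum_congr rfl fun m' hm' => ?_
    have : ∀ m ∈ R, ∫ x, f.coeff m * f.coeff m' * ((∏ i, (P (m i)).eval (x i)) * H m' x) ∂μ =
        if m = m' then f.coeff m' ^ 2 * K m' else 0 := by
      intro m hm
      rw [integral_const_mul, horth P hP hPκ m m' ((hR m hm).trans_eq (hSd m' hm').symm)]
      split_ifs with h
      · subst h; ring
      · simp
    rw [Finset.sum_congr rfl this, Finset.sum_ite_eq' R m', if_pos (hSR hm')]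
  obtain ⟨hi1, h1⟩ := hgen (fun k => Polynomial.X ^ k) (fun k => Polynomial.degree_X_pow k)
    (by simpa using hXπ) f.support (Finset.filter_subset _ _) hfd
  obtain ⟨hi2, h2⟩ := hgen π (fun k => by
      rw [Polynomial.degree_eq_natDegree (hπm k).ne_zero, hπd])
    (fun k => by simp only [hκ, sq]) S subset_rfl (fun m hm => (hSd m hm).le)
  simp only [← hfx] at hi1 h1
  have hiF : Integrable (fun x => (MvPolynomial.eval x f) ^ 2) μ := by
    simp only [sq, hfx, Finset.sum_mul_sum]
    refine integrable_finsetSum _ fun m _ => integrable_finsetSum _ fun m' _ => ?_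
    have := (hprodint (fun i => Polynomial.X ^ (m i)) (fun i => Polynomial.X ^ (m' i))).const_mul
      (f.coeff m * f.coeff m')
    refine this.congr (.of_forall fun x => ?_)
    simp only
    ring
  have h3 : 0 ≤ ∫ x, (MvPolynomial.eval x f - T x) ^ 2 ∂μ := integral_nonneg fun x => sq_nonneg _
  have h4 : ∫ x, (MvPolynomial.eval x f - T x) ^ 2 ∂μ =
      ∫ x, (MvPolynomial.eval x f) ^ 2 ∂μ - ∑ m ∈ S, f.coeff m ^ 2 * K m := by
    have e : ∀ x, (MvPolynomial.eval x f - T x) ^ 2 = (MvPolynomial.eval x f) ^ 2 -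
        2 * (MvPolynomial.eval x f * T x) + T x * T x := fun x => by ring
    simp_rw [e]
    have hi2' : Integrable (fun x => T x * T x) μ := hi2
    rw [integral_add (f := fun x => (MvPolynomial.eval x f) ^ 2 - 2 * (MvPolynomial.eval x f * T x))
      (hiF.sub (hi1.const_mul 2)) hi2', integral_sub hiF (hi1.const_mul 2),
      integral_const_mul, h1]
    have h2' : ∫ x, T x * T x ∂μ = ∑ m ∈ S, f.coeff m ^ 2 * K m := h2
    rw [h2']; ring
  have h5 : c ^ d * (coeffd d f) ^ 2 ≤ ∑ m ∈ S, f.coeff m ^ 2 * K m := by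
    rw [coeffd, Real.sq_sqrt (Finset.sum_nonneg fun m _ => sq_nonneg _), Finset.mul_sum]
    refine Finset.sum_le_sum fun m hm => ?_
    rw [mul_comm]
    refine mul_le_mul_of_nonneg_left ?_ (sq_nonneg _)
    rw [← hSd m hm, ← Finset.prod_pow_eq_pow_sum]
    refine Finset.prod_le_prod (fun i _ => by positivity) fun i _ => ?_
    have := hlow (π (m i)) (hπm _)
    rwa [hπd] at this
  linarith

theorem integrable_sq_mul_expEnvelope : Integrable fun s : ℝ => s ^ 2 * expEnvelope s := by
  refine ((integrable_exp_neg_mul_abs (b := 1 / 6) (by norm_num)).const_mul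
    (72 * Real.exp 1)).mono' (by
      have := continuous_expEnvelope
      exact Continuous.aestronglyMeasurable (by fun_prop)) (.of_forall fun s => ?_)
  have h0 : 0 ≤ expEnvelope s := (Real.exp_pos _).le
  rw [Real.norm_of_nonneg (by positivity)]
  have h1 := Real.quadratic_le_exp_of_nonneg (x := |s| / 6) (by positivity)
  have h2 : s ^ 2 ≤ 72 * Real.exp (|s| / 6) := by
    have : (|s| / 6) ^ 2 = s ^ 2 / 36 := by rw [div_pow, sq_abs]; norm_num
    rw [this] at h1
    have := abs_nonneg s
    linarith
  calc s ^ 2 * expEnvelope s ≤ 72 * Real.exp (|s| / 6) * expEnvelope s := by gcongr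
    _ = 72 * (Real.exp (|s| / 6) * Real.exp (1 - |s| / 3)) := by rw [expEnvelope]; ring
    _ = 72 * (Real.exp 1 * Real.exp (-(1 / 6 * |s|))) := by
      rw [← Real.exp_add, ← Real.exp_add]; ring_nf
    _ = _ := by ring

/-- Away from the boundary of its support, a log-concave density is continuous, and the
measure is carried by the interior of the support. -/
theorem exists_isOpen_continuousOn_of_logConcave {ν : Measure ℝ} {ρ : ℝ → ℝ}
    (hlc : ∀ x y l : ℝ, 0 ≤ l → l ≤ 1 → ρ x ^ (1 - l) * ρ y ^ l ≤ ρ ((1 - l) * x + l * y))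
    (hν : ν = volume.withDensity (fun x => ENNReal.ofReal (ρ x))) :
    ∃ U : Set ℝ, IsOpen U ∧ U.OrdConnected ∧ ContinuousOn ρ U ∧ ν Uᶜ = 0 := by
  set S := {x | 0 < ρ x} with hS
  have hSc : Convex ℝ S := by
    rw [convex_iff_forall_pos]
    intro x hx y hy a b ha hb hab
    have ha' : a = 1 - b := by linarith
    subst ha'
    exact lt_of_lt_of_le (mul_pos (Real.rpow_pos_of_pos hx _) (Real.rpow_pos_of_pos hy _))
      (hlc x y b hb.le (by linarith))
  have hconc : ConcaveOn ℝ S fun x => Real.log (ρ x) := by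
    refine ⟨hSc, fun x hx y hy a b ha hb hab => ?_⟩
    have hx : 0 < ρ x := hx
    have hy : 0 < ρ y := hy
    have ha' : a = 1 - b := by linarith
    subst ha'
    have h1 := hlc x y b hb (by linarith)
    have h2 := Real.log_le_log (mul_pos (Real.rpow_pos_of_pos hx _) (Real.rpow_pos_of_pos hy _)) h1
    rw [Real.log_mul (Real.rpow_pos_of_pos hx _).ne' (Real.rpow_pos_of_pos hy _).ne',
      Real.log_rpow hx, Real.log_rpow hy] at h2
    exact h2
  refine ⟨interior S, isOpen_interior, hSc.interior.ordConnected, ?_, ?_⟩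
  · have := hconc.continuousOn_interior
    refine (Real.continuous_exp.comp_continuousOn this).congr fun x hx => ?_
    have hxS : x ∈ S := interior_subset hx
    exact (Real.exp_log hxS).symm
  · have hSm : MeasurableSet S := hSc.ordConnected.measurableSet
    have h1 : ν Sᶜ = 0 := by
      rw [hν, withDensity_apply _ hSm.compl]
      refine (setLIntegral_congr_fun hSm.compl fun x hx => ?_).trans lintegral_zero
      have hx : ¬ 0 < ρ x := hx
      exact ENNReal.ofReal_of_nonpos (not_lt.1 hx)
    have h2 : ν (frontier S) = 0 := by
      rw [hν]
      exact withDensity_absolutelyContinuous _ _ (hSc.addHaar_frontier _)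
    refine measure_mono_null ?_ (measure_union_null h1 h2)
    intro x hx
    by_cases hxS : x ∈ S
    · exact Or.inr ⟨subset_closure hxS, hx⟩
    · exact Or.inl hxS

/-- Up to small mass, an isotropic log-concave measure is dominated by a probability measure on
a compact interval with a continuous log-concave density bounded by a universal constant. -/
theorem exists_truncation : ∃ M : ℝ, 1 ≤ M ∧ ∀ ν : Measure ℝ, IsProbabilityMeasure ν →
    IsLogConcaveMeasure ν → (∫ x, x ∂ν = 0) → (∫ x, x ^ 2 ∂ν = 1) → ∀ δ : ℝ, 0 < δ →
    ∃ (α β : ℝ) (q : ℝ → ℝ), Continuous q ∧ (∀ t, 0 ≤ q t) ∧ LogConcaveOn (Set.Icc α β) q ∧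
      (∫ t in Set.Icc α β, q t = 1) ∧ (∀ t ∈ Set.Icc α β, q t ≤ M) ∧
      ν.restrict (Set.Icc α β) ≤
        (volume.restrict (Set.Icc α β)).withDensity (fun t => ENNReal.ofReal (q t)) ∧
      1 - δ ≤ ν.real (Set.Icc α β) := by
  set A := ∫ s : ℝ, s ^ 2 * expEnvelope s with hA
  refine ⟨max 1 (Real.sqrt (2 * A)), le_max_left _ _, ?_⟩
  intro ν _ ⟨ρ, hρ0, hlc, hν⟩ hmean hvar δ hδ
  obtain ⟨U, hUo, hUc, hρc, hUν⟩ := exists_isOpen_continuousOn_of_logConcave hlc hν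
  have hi2 : Integrable (fun x : ℝ => x ^ 2) ν := by
    by_contra h
    rw [integral_undef h] at hvar
    exact zero_ne_one hvar
  have hi1 : Integrable (fun x : ℝ => x) ν := by
    refine (hi2.add (integrable_const 1)).mono' (by fun_prop) (.of_forall fun x => ?_)
    simp only [Pi.add_apply, Real.norm_eq_abs]
    nlinarith [sq_abs x, sq_nonneg (|x| - 1)]
  have hi12 : Integrable (fun x : ℝ => 1 + x ^ 2) ν := (integrable_const 1).add hi2
  have hI12 : ∫ x, (1 + x ^ 2) ∂ν = 2 := by
    rw [integral_add (integrable_const 1) hi2, hvar]; simp; norm_num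
  set η := min δ (1 / 10) with hη
  have hη0 : 0 < η := lt_min hδ (by norm_num)
  -- a compact subinterval carrying almost all the mass and second moment
  obtain ⟨α, β, hJU, hne, hJ⟩ : ∃ α β : ℝ, Set.Icc α β ⊆ U ∧ α ≤ β ∧
      ∫ x in (Set.Icc α β)ᶜ, (1 + x ^ 2) ∂ν ≤ η := by
    set ν' := ν.withDensity (fun x => ENNReal.ofReal (1 + x ^ 2)) with hν'
    have : IsFiniteMeasure ν' := isFiniteMeasure_withDensity_ofReal hi12.2
    have hfull : ν' U = 2 := by
      have h0 : ν' Uᶜ = 0 := withDensity_absolutelyContinuous _ _ hUν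
      rw [measure_of_measure_compl_eq_zero h0, hν', withDensity_apply _ .univ,
        Measure.restrict_univ,
        ← ofReal_integral_eq_lintegral_ofReal hi12 (.of_forall fun x => by positivity), hI12]
      simp
    have hlt : ENNReal.ofReal (2 - η) < ν' U := by
      rw [hfull, ← ENNReal.ofReal_ofNat]
      exact (ENNReal.ofReal_lt_ofReal_iff (by norm_num)).2 (by linarith)
    obtain ⟨K, hKU, hK, hKν⟩ := hUo.exists_lt_isCompact hlt
    have hKne : K.Nonempty := by
      by_contra h
      rw [Set.not_nonempty_iff_eq_empty] at h
      rw [h] at hKν; simp at hKν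
    have hKsub : K ⊆ Set.Icc (sInf K) (sSup K) := fun x hx =>
      ⟨csInf_le hK.bddBelow hx, le_csSup hK.bddAbove hx⟩
    refine ⟨sInf K, sSup K, hUc.out (hKU (hK.sInf_mem hKne)) (hKU (hK.sSup_mem hKne)),
      Real.sInf_le_sSup _ hK.bddBelow hK.bddAbove, ?_⟩
    have h1 := hKν.trans_le (measure_mono (μ := ν') hKsub)
    rw [hν', withDensity_apply _ measurableSet_Icc, ← ofReal_integral_eq_lintegral_ofReal
      hi12.integrableOn (.of_forall fun x => by positivity)] at h1
    have h2 := (ENNReal.ofReal_lt_ofReal_iff_of_nonneg (by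
      have : η ≤ 1 / 10 := min_le_right _ _
      linarith)).1 h1
    have h3 := integral_add_compl (measurableSet_Icc (a := sInf K) (b := sSup K)) hi12
    rw [hI12] at h3
    linarith
  set J := Set.Icc α β with hJdef
  have hη1 : η ≤ 1 / 10 := min_le_right _ _
  have hηδ : η ≤ δ := min_le_left _ _
  have hJm : MeasurableSet J := measurableSet_Icc
  have hcompl1 : ν.real Jᶜ ≤ η := by
    have : ∫ x in Jᶜ, (1 : ℝ) ∂ν ≤ ∫ x in Jᶜ, (1 + x ^ 2) ∂ν :=
      setIntegral_mono_on (by simp) hi12.integrableOn hJm.compl fun x _ => by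
        nlinarith [sq_nonneg x]
    simp only [setIntegral_const, smul_eq_mul, mul_one] at this
    linarith
  have hmass : 1 - η ≤ ν.real J := by
    have := measureReal_add_measureReal_compl (μ := ν) hJm
    rw [probReal_univ] at this
    linarith
  have hsec : 9 / 10 ≤ ∫ x in J, x ^ 2 ∂ν := by
    have h1 : ∫ x in Jᶜ, x ^ 2 ∂ν ≤ ∫ x in Jᶜ, (1 + x ^ 2) ∂ν :=
      setIntegral_mono_on hi2.integrableOn hi12.integrableOn hJm.compl fun x _ => by linarith
    have h2 := integral_add_compl hJm hi2
    rw [hvar] at h2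
    linarith
  have hfirst : |∫ x in J, x ∂ν| ≤ 1 / 10 := by
    have h2 := integral_add_compl hJm hi1
    rw [hmean] at h2
    have h3 : |∫ x in J, x ∂ν| = |∫ x in Jᶜ, x ∂ν| := by
      rw [← abs_neg]; congr 1; linarith
    rw [h3]
    calc |∫ x in Jᶜ, x ∂ν| ≤ ∫ x in Jᶜ, |x| ∂ν := abs_integral_le_integral_abs
      _ ≤ ∫ x in Jᶜ, (1 + x ^ 2) ∂ν :=
        setIntegral_mono_on hi1.abs.integrableOn hi12.integrableOn hJm.compl fun x _ => by
          nlinarith [sq_abs x, sq_nonneg (|x| - 1), abs_nonneg x]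
      _ ≤ _ := by linarith
  set w : ℝ → ℝ := Set.IccExtend hne (J.domRestrict ρ) with hw
  have hwc : Continuous w :=
    (continuousOn_iff_continuous_domRestrict.1 (hρc.mono hJU)).Icc_extend'
  have hw0 : ∀ t, 0 ≤ w t := fun t => hρ0 _
  have hwρ : ∀ t ∈ J, w t = ρ t := fun t ht => Set.IccExtend_of_mem hne _ ht
  have hwlc : LogConcaveOn J w := by
    intro x hx y hy l hl0 hl1
    have hm : (1 - l) • x + l • y ∈ J :=
      convex_Icc α β hx hy (by linarith) hl0 (by ring)
    rw [hwρ x hx, hwρ y hy, hwρ _ hm]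
    exact hlc x y l hl0 hl1
  have hνJ : ν.restrict J = (volume.restrict J).withDensity (fun t => ENNReal.ofReal (w t)) := by
    rw [hν, restrict_withDensity hJm]
    refine withDensity_congr_ae ?_
    filter_upwards [ae_restrict_mem hJm] with t ht
    rw [hwρ t ht]
  have htrans : ∀ g : ℝ → ℝ, ∫ t in J, g t ∂ν = ∫ t in J, w t * g t := by
    intro g
    rw [hνJ, integral_withDensity_eq_integral_toReal_smul (by fun_prop) (by simp)]
    simp [ENNReal.toReal_ofReal (hw0 _)]
  set W := ∫ t in J, w t with hW
  have hWν : W = ν.real J := by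
    have := htrans fun _ => 1
    simp at this
    linarith
  have hWpos : 0 < W := by linarith
  have hW1 : W ≤ 1 := hWν ▸ measureReal_le_one
  obtain ⟨t0, ht0, m, hm, hmeq, hmax, hdecay⟩ := hwlc.exists_decay hwc hw0 hWpos
  have hmle : m ≤ max 1 (Real.sqrt (2 * A)) := by
    refine le_max_of_le_right (Real.le_sqrt_of_sq_le ?_)
    have h1 : 1 / 2 ≤ ∫ x in J, (x - t0) ^ 2 ∂ν := by
      have e : ∀ x : ℝ, (x - t0) ^ 2 = x ^ 2 - 2 * t0 * x + t0 ^ 2 := fun x => by ring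
      simp_rw [e]
      have hi21 : Integrable (fun x : ℝ => x ^ 2 - 2 * t0 * x) ν := hi2.sub (hi1.const_mul (2 * t0))
      rw [integral_add hi21.integrableOn (integrable_const _),
        integral_sub hi2.integrableOn (hi1.integrableOn.const_mul _),
        integral_const_mul, setIntegral_const, smul_eq_mul]
      have h3 := abs_le.1 hfirst
      have h4 : 2 * t0 * (∫ x in J, x ∂ν) ≤ 2 * |t0| * (1 / 10) := by
        calc _ ≤ |2 * t0 * (∫ x in J, x ∂ν)| := le_abs_self _
          _ = 2 * |t0| * |∫ x in J, x ∂ν| := by rw [abs_mul, abs_mul]; simp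
          _ ≤ _ := by gcongr
      have h5 : (9 / 10) * t0 ^ 2 ≤ ν.real J * t0 ^ 2 := by gcongr; linarith
      nlinarith [sq_abs t0, sq_nonneg (|t0| - 1 / 5)]
    have hGi : Integrable fun x : ℝ => (m * (x - t0)) ^ 2 * expEnvelope (m * (x - t0)) :=
      (integrable_sq_mul_expEnvelope.comp_mul_left' hm.ne').comp_sub_right t0
    have hG : ∫ x : ℝ, (m * (x - t0)) ^ 2 * expEnvelope (m * (x - t0)) = m⁻¹ * A := by
      rw [integral_sub_right_eq_self (fun x : ℝ => (m * x) ^ 2 * expEnvelope (m * x)) t0,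
        Measure.integral_comp_mul_left (fun s : ℝ => s ^ 2 * expEnvelope s) m]
      rw [abs_of_pos (inv_pos.2 hm), smul_eq_mul]
    have h2 : ∫ x in J, (x - t0) ^ 2 ∂ν ≤ W * m⁻¹ * (m⁻¹ * A) := by
      rw [htrans, ← hG, ← integral_const_mul]
      refine le_trans ?_ (setIntegral_le_integral (s := J) (hGi.const_mul _) (.of_forall fun x => by
        have : 0 ≤ expEnvelope (m * (x - t0)) := (Real.exp_pos _).le
        simp only [Pi.zero_apply]
        positivity))
      refine setIntegral_mono_on ?_ (hGi.const_mul _).integrableOn hJm fun x hx => ?_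
      · exact (Continuous.continuousOn (by fun_prop)).integrableOn_compact isCompact_Icc
      · have := hdecay x hx
        rw [div_le_iff₀ hWpos] at this
        calc w x * (x - t0) ^ 2 ≤ m * expEnvelope (m * (x - t0)) * W * (x - t0) ^ 2 := by gcongr
          _ = _ := by field_simp
    have hA0 : 0 ≤ A := integral_nonneg fun s => mul_nonneg (sq_nonneg _) (Real.exp_pos _).le
    have h3 : W * m⁻¹ * (m⁻¹ * A) ≤ A / m ^ 2 := by
      calc W * m⁻¹ * (m⁻¹ * A) ≤ 1 * m⁻¹ * (m⁻¹ * A) := by gcongr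
        _ = _ := by field_simp
    have h4 : 1 / 2 ≤ A / m ^ 2 := by linarith
    rw [le_div_iff₀ (by positivity)] at h4
    linarith
  refine ⟨α, β, fun t => w t / W, by fun_prop, fun t => div_nonneg (hw0 t) hWpos.le, ?_, ?_, ?_, ?_,
    by linarith⟩
  · intro x hx y hy l hl0 hl1
    simp only
    rw [Real.div_rpow (hw0 _) hWpos.le, Real.div_rpow (hw0 _) hWpos.le, div_mul_div_comm,
      ← Real.rpow_add hWpos, sub_add_cancel, Real.rpow_one]
    exact div_le_div_of_nonneg_right (hwlc x hx y hy l hl0 hl1) hWpos.le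
  · rw [integral_div]; exact div_self hWpos.ne'
  · intro t ht
    refine le_trans ?_ hmle
    rw [hmeq]
    exact div_le_div_of_nonneg_right (hmax t ht) hWpos.le
  · rw [hνJ]
    refine withDensity_mono (.of_forall fun t => ENNReal.ofReal_le_ofReal ?_)
    exact le_div_self (hw0 t) hWpos hW1

theorem MeasureTheory.Measure.pi_le_pi {ι : Type*} [Fintype ι] {X : ι → Type*}
    [∀ i, MeasurableSpace (X i)] {μ ν : ∀ i, Measure (X i)} [∀ i, SigmaFinite (μ i)]
    (h : ∀ i, μ i ≤ ν i) : Measure.pi μ ≤ Measure.pi ν := by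
  have h1 : (Measure.pi μ).toOuterMeasure ≤
      OuterMeasure.pi fun i => (ν i).toOuterMeasure := by
    rw [OuterMeasure.le_pi]
    intro s _
    exact (Measure.pi_pi μ s).trans_le (Finset.prod_le_prod' fun i _ => h i (s i))
  refine Measure.le_iff.2 fun s hs => ?_
  refine (h1 s).trans ?_
  rw [Measure.pi]
  exact le_toMeasure_apply _ _ s

theorem pi_withDensity_ofReal {n : ℕ} {κ : Measure ℝ} [SigmaFinite κ] {q : ℝ → ℝ}
    (hq0 : ∀ t, 0 ≤ q t) (hq : Integrable q κ) :
    Measure.pi (fun _ : Fin n => κ.withDensity fun t => ENNReal.ofReal (q t)) =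
      (Measure.pi fun _ : Fin n => κ).withDensity fun x => ENNReal.ofReal (∏ i, q (x i)) := by
  have : IsFiniteMeasure (κ.withDensity fun t => ENNReal.ofReal (q t)) :=
    isFiniteMeasure_withDensity_ofReal hq.2
  refine Measure.pi_eq fun s hs => ?_
  rw [withDensity_apply _ (MeasurableSet.univ_pi hs), Measure.restrict_pi_pi]
  have hi : ∀ i, Integrable q (κ.restrict (s i)) := fun i => hq.integrableOn
  rw [← ofReal_integral_eq_lintegral_ofReal
    (Integrable.fintype_prod (f := fun _ : Fin n => q) hi)
    (.of_forall fun x => Finset.prod_nonneg fun i _ => hq0 _),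
    integral_fintype_prod_eq_prod (μ := fun i => κ.restrict (s i)) (fun _ : Fin n => q),
    ENNReal.ofReal_prod_of_nonneg fun i _ => integral_nonneg fun t => hq0 t]
  refine Finset.prod_congr rfl fun i _ => ?_
  rw [withDensity_apply _ (hs i), ofReal_integral_eq_lintegral_ofReal (hi i)
    (.of_forall fun t => hq0 t)]

theorem Continuous.integrable_cubeMeasure {α β : ℝ} {n : ℕ} {F : (Fin n → ℝ) → ℝ}
    (hF : Continuous F) : Integrable F (cubeMeasure α β n) := by
  rw [cubeMeasure_eq]
  exact hF.continuousOn.integrableOn_compact (isCompact_cube α β n)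

theorem LogConcaveOn.prod_comp_snd {q : ℝ → ℝ} {α β a b : ℝ} {n : ℕ} (hq0 : ∀ t, 0 ≤ q t)
    (hq : LogConcaveOn (Set.Icc α β) q) :
    LogConcaveOn (Set.Icc a b ×ˢ Set.univ.pi fun _ : Fin n => Set.Icc α β)
      fun z : ℝ × (Fin n → ℝ) => ∏ i, q (z.2 i) := by
  intro x hx y hy l hl0 hl1
  simp only
  rw [← Real.finsetProd_rpow _ _ (fun i _ => hq0 _), ← Real.finsetProd_rpow _ _ (fun i _ => hq0 _),
    ← Finset.prod_mul_distrib]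
  refine Finset.prod_le_prod (fun i _ => mul_nonneg (Real.rpow_nonneg (hq0 _) _)
    (Real.rpow_nonneg (hq0 _) _)) fun i _ => ?_
  exact hq _ (hx.2 i (Set.mem_univ i)) _ (hy.2 i (Set.mem_univ i)) l hl0 hl1

theorem MvPolynomial.exists_polynomial_line {n d : ℕ} {f : MvPolynomial (Fin n) ℝ}
    (hf : f.totalDegree ≤ d) (c v : Fin n → ℝ) :
    ∃ P : Polynomial ℝ, P.natDegree ≤ d ∧ ∀ t, P.eval t = MvPolynomial.eval (c + t • v) f := by
  refine ⟨MvPolynomial.aeval (fun i => Polynomial.C (c i) + Polynomial.X * Polynomial.C (v i)) f,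
    ?_, fun t => ?_⟩
  · have := MvPolynomial.aeval_natDegree_le f hf
      (fun i => Polynomial.C (c i) + Polynomial.X * Polynomial.C (v i)) (n := 1) fun i => by
        compute_degree
    simpa using this
  · have h := MvPolynomial.aeval_def (R := ℝ)
      (fun i => Polynomial.C (c i) + Polynomial.X * Polynomial.C (v i)) f
    rw [h, ← Polynomial.coe_evalRingHom, MvPolynomial.hom_eval₂]
    rw [MvPolynomial.eval, MvPolynomial.coe_eval₂Hom]
    congr 1
    · ext; simp
    · ext i
      simp only [Polynomial.coe_evalRingHom, Polynomial.eval_add,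
        Polynomial.eval_mul, Polynomial.eval_C, Polynomial.eval_X, Pi.add_apply, Pi.smul_apply,
        smul_eq_mul]

theorem isProbabilityMeasure_withDensity_Icc {α β : ℝ} {q : ℝ → ℝ} (hq : Continuous q)
    (hq0 : ∀ t, 0 ≤ q t) (hq1 : ∫ t in Set.Icc α β, q t = 1) :
    IsProbabilityMeasure
      ((volume.restrict (Set.Icc α β)).withDensity fun t => ENNReal.ofReal (q t)) := by
  have hqi : Integrable q (volume.restrict (Set.Icc α β)) :=
    hq.continuousOn.integrableOn_compact isCompact_Icc
  constructor
  rw [withDensity_apply _ .univ, Measure.restrict_univ,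
    ← ofReal_integral_eq_lintegral_ofReal hqi (.of_forall hq0), hq1, ENNReal.ofReal_one]

theorem pow_mul_coeffd_sq_le_integral_of_density {M α β : ℝ} (hM : 1 ≤ M) {q : ℝ → ℝ}
    (hq : Continuous q) (hq0 : ∀ t, 0 ≤ q t) (hq1 : ∫ t in Set.Icc α β, q t = 1)
    (hqM : ∀ t ∈ Set.Icc α β, q t ≤ M)
    {n d : ℕ} {f : MvPolynomial (Fin n) ℝ} (hf : f.totalDegree ≤ d) :
    (1 / (288 * M ^ 2)) ^ d * coeffd d f ^ 2 ≤ ∫ x, MvPolynomial.eval x f ^ 2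
      ∂(Measure.pi fun _ : Fin n => (volume.restrict (Set.Icc α β)).withDensity
        fun t => ENNReal.ofReal (q t)) := by
  have hprob := isProbabilityMeasure_withDensity_Icc hq hq0 hq1
  have hηM : (volume.restrict (Set.Icc α β)).withDensity (fun t => ENNReal.ofReal (q t)) ≤
      ENNReal.ofReal M • volume := by
    calc _ ≤ (volume.restrict (Set.Icc α β)).withDensity fun _ => ENNReal.ofReal M := by
          refine withDensity_mono ?_
          filter_upwards [ae_restrict_mem measurableSet_Icc] with t ht
          exact ENNReal.ofReal_le_ofReal (hqM t ht)
      _ = ENNReal.ofReal M • volume.restrict (Set.Icc α β) := withDensity_const _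
      _ ≤ _ := by gcongr; exact Measure.restrict_le_self
  have hqm : Measurable fun t => ENNReal.ofReal (q t) := by fun_prop
  have hcont : ∀ G : ℝ → ℝ, Continuous G → Integrable G
      ((volume.restrict (Set.Icc α β)).withDensity fun t => ENNReal.ofReal (q t)) := by
    intro G hG
    rw [integrable_withDensity_iff_integrable_smul' hqm (.of_forall fun _ => ENNReal.ofReal_lt_top)]
    simp only [ENNReal.toReal_ofReal (hq0 _), smul_eq_mul]
    exact (hq.mul hG).continuousOn.integrableOn_compact isCompact_Icc
  have hM0 : 0 < M := by linarith
  exact pow_mul_coeffd_sq_le_integral (by positivity) (fun P => hcont _ P.continuous)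
    (fun P hP => hP.pow_le_integral_eval_sq hM hηM (hcont _ (P.continuous.pow 2))) hf

theorem Continuous.integrable_withDensity_cubeMeasure {α β : ℝ} {n : ℕ} {p G : (Fin n → ℝ) → ℝ}
    (hp : Continuous p) (hp0 : ∀ x, 0 ≤ p x) (hG : Continuous G) :
    Integrable G ((cubeMeasure α β n).withDensity fun x => ENNReal.ofReal (p x)) := by
  have hpm : Measurable fun x => ENNReal.ofReal (p x) := by fun_prop
  rw [integrable_withDensity_iff_integrable_smul' hpm (.of_forall fun _ => ENNReal.ofReal_lt_top)]
  simp only [ENNReal.toReal_ofReal (hp0 _), smul_eq_mul]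
  exact (hp.mul hG).integrable_cubeMeasure

theorem integral_prod_cubeMeasure_eq {α β : ℝ} {n : ℕ} {p G : (Fin n → ℝ) → ℝ}
    (hp : Continuous p) (hp0 : ∀ x, 0 ≤ p x) (hG : Continuous G) (s : ℝ)
    [IsProbabilityMeasure ((cubeMeasure α β n).withDensity fun x => ENNReal.ofReal (p x))] :
    ∫ z : ℝ × (Fin n → ℝ), (G z.2 - s) * p z.2
        ∂((volume.restrict (Set.Icc 0 1)).prod (cubeMeasure α β n)) =
      ∫ x, G x ∂((cubeMeasure α β n).withDensity fun x => ENNReal.ofReal (p x)) - s := by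
  have hpm : Measurable fun x => ENNReal.ofReal (p x) := by fun_prop
  rw [integral_fun_snd (fun x => (G x - s) * p x)]
  have h1 : ∫ x, G x ∂((cubeMeasure α β n).withDensity fun x => ENNReal.ofReal (p x)) - s =
      ∫ x, (G x - s) ∂((cubeMeasure α β n).withDensity fun x => ENNReal.ofReal (p x)) := by
    rw [integral_sub (hp.integrable_withDensity_cubeMeasure hp0 hG) (integrable_const _)]
    simp
  rw [h1, integral_withDensity_eq_integral_toReal_smul hpm
    (.of_forall fun _ => ENNReal.ofReal_lt_top)]
  simp only [ENNReal.toReal_ofReal (hp0 _), smul_eq_mul, mul_comm]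
  simp

theorem two_mul_rpow_lt_smallBall_bound {C c κ ε : ℝ} {d : ℕ} (hd : 0 < d) (hC : 0 < C) (hc : 0 < c)
    (hκ : 0 < κ) (hε : 0 < ε) :
    C * d * (2 * ε) ^ ((1 : ℝ) / d) <
      8 * C / Real.sqrt c * d * (ε / κ) ^ ((1 : ℝ) / d) *
        (c ^ d * κ ^ 2 / 2) ^ ((1 : ℝ) / (2 * d)) := by
  have hd0 : (0 : ℝ) < d := by exact_mod_cast hd
  have h4 : Real.sqrt c * κ ^ ((1 : ℝ) / d) / 2 ≤ (c ^ d * κ ^ 2 / 2) ^ ((1 : ℝ) / (2 * d)) := by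
    have e1 : (2 : ℝ) ^ ((1 : ℝ) / (2 * d)) ≤ 2 := by
      conv_rhs => rw [← Real.rpow_one 2]
      refine Real.rpow_le_rpow_of_exponent_le (by norm_num) ?_
      rw [div_le_one (by positivity)]
      have : (1 : ℝ) ≤ d := by exact_mod_cast hd
      linarith
    rw [Real.div_rpow (by positivity) (by norm_num), Real.mul_rpow (by positivity)
      (by positivity), ← Real.rpow_natCast c, ← Real.rpow_mul hc.le,
      ← Real.rpow_natCast (κ), ← Real.rpow_mul hκ.le, Real.sqrt_eq_rpow]
    have e2 : (d : ℝ) * (1 / (2 * d)) = 1 / 2 := by field_simp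
    have e3 : ((2 : ℕ) : ℝ) * (1 / (2 * d)) = 1 / d := by push_cast; field_simp
    rw [e2, e3]
    exact div_le_div_of_nonneg_left (by positivity) (by positivity) e1
  have h5 : (2 * ε) ^ ((1 : ℝ) / d) ≤ 2 * ε ^ ((1 : ℝ) / d) := by
    rw [Real.mul_rpow (by norm_num) hε.le]
    gcongr
    conv_rhs => rw [← Real.rpow_one 2]
    refine Real.rpow_le_rpow_of_exponent_le (by norm_num) ?_
    rw [div_le_one hd0]
    exact_mod_cast hd
  have hT0 : 0 < 8 * C / Real.sqrt c * d * (ε / κ) ^ ((1 : ℝ) / d) := by positivity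
  have h7 : 8 * C / Real.sqrt c * d * (ε / κ) ^ ((1 : ℝ) / d) *
      (Real.sqrt c * κ ^ ((1 : ℝ) / d) / 2) = 2 * (C * d * (2 * ε ^ ((1 : ℝ) / d))) := by
    rw [Real.div_rpow hε.le hκ.le]
    have : 0 < κ ^ ((1 : ℝ) / d) := by positivity
    have : 0 < Real.sqrt c := by positivity
    field_simp
    norm_num
  have h8 : 0 < C * d * (2 * ε ^ ((1 : ℝ) / d)) := by positivity
  calc C * d * (2 * ε) ^ ((1 : ℝ) / d) ≤ C * d * (2 * ε ^ ((1 : ℝ) / d)) :=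
        mul_le_mul_of_nonneg_left h5 (by positivity)
    _ < 2 * (C * d * (2 * ε ^ ((1 : ℝ) / d))) := by linarith
    _ = _ := h7.symm
    _ ≤ _ := mul_le_mul_of_nonneg_left h4 hT0.le

/-- The small-ball estimate for products of compactly supported log-concave densities. -/
theorem exists_smallBall_of_density {M : ℝ} (hM : 1 ≤ M) : ∃ C : ℝ, 0 < C ∧
    ∀ (α β : ℝ) (q : ℝ → ℝ), Continuous q → (∀ t, 0 ≤ q t) → LogConcaveOn (Set.Icc α β) q →
      (∫ t in Set.Icc α β, q t = 1) → (∀ t ∈ Set.Icc α β, q t ≤ M) →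
      ∀ (n d : ℕ), 0 < d → ∀ f : MvPolynomial (Fin n) ℝ, f.totalDegree ≤ d →
        0 < coeffd d f → ∀ ε : ℝ, 0 < ε →
        (Measure.pi fun _ : Fin n => (volume.restrict (Set.Icc α β)).withDensity
          fun t => ENNReal.ofReal (q t)) {x | |MvPolynomial.eval x f| ≤ ε} ≤
          ENNReal.ofReal (C * d * (ε / coeffd d f) ^ ((1 : ℝ) / d)) := by
  obtain ⟨C₁, hC₁, hone⟩ := exists_oneDim_smallBall
  have hM0 : 0 < M := by linarith
  obtain ⟨c, hc⟩ : ∃ c, c = 1 / (288 * M ^ 2) := ⟨_, rfl⟩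
  have hc0 : 0 < c := by rw [hc]; positivity
  refine ⟨8 * C₁ / Real.sqrt c, by positivity, ?_⟩
  intro α β q hq hq0 hqlc hq1 hqM n d hd f hf hcoef ε hε
  have hprob := isProbabilityMeasure_withDensity_Icc hq hq0 hq1
  have hL2 := pow_mul_coeffd_sq_le_integral_of_density hM hq hq0 hq1 hqM hf
  rw [← hc] at hL2
  have hp0 : ∀ x : Fin n → ℝ, 0 ≤ ∏ i, q (x i) := fun x => Finset.prod_nonneg fun i _ => hq0 _
  have hpc : Continuous fun x : Fin n → ℝ => ∏ i, q (x i) := by fun_prop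
  have hμd := pi_withDensity_ofReal (n := n) hq0
    (hq.continuousOn.integrableOn_compact isCompact_Icc : IntegrableOn q (Set.Icc α β))
  change _ = (cubeMeasure α β n).withDensity _ at hμd
  have hμp : IsProbabilityMeasure
      ((cubeMeasure α β n).withDensity fun x => ENNReal.ofReal (∏ i, q (x i))) := by
    rw [← hμd]
    infer_instance
  rw [hμd] at hL2 ⊢
  have hint : ∀ G : (Fin n → ℝ) → ℝ, Continuous G → Integrable G
      ((cubeMeasure α β n).withDensity fun x => ENNReal.ofReal (∏ i, q (x i))) :=
    fun G hG => hpc.integrable_withDensity_cubeMeasure hp0 hG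
  have htrans := fun G hG =>
    integral_prod_cubeMeasure_eq (α := α) (β := β) (G := G) hpc hp0 hG
  generalize (cubeMeasure α β n).withDensity (fun x => ENNReal.ofReal (∏ i, q (x i))) = μ
    at hμp hL2 hint htrans ⊢
  have hFc : Continuous fun x => MvPolynomial.eval x f := MvPolynomial.continuous_eval f
  obtain ⟨θ, hθ⟩ : ∃ θ, θ = 8 * C₁ / Real.sqrt c * d * (ε / coeffd d f) ^ ((1 : ℝ) / d) := ⟨_, rfl⟩
  rw [← hθ]
  have hθ0 : 0 < θ := by rw [hθ]; positivity
  obtain ⟨τ, hτ⟩ : ∃ τ, τ = c ^ d * coeffd d f ^ 2 / 2 := ⟨_, rfl⟩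
  have hτ0 : 0 < τ := by rw [hτ]; positivity
  by_contra hcon
  push Not at hcon
  set A := {x : Fin n → ℝ | |MvPolynomial.eval x f| ≤ ε} with hA
  have hAm : MeasurableSet A := measurableSet_le (by fun_prop) measurable_const
  let ψ : ℝ → ℝ := fun u => max 0 (min 1 (2 - |u| / ε))
  have hψc : Continuous fun x => ψ (MvPolynomial.eval x f) := by fun_prop
  have h1 : 0 < ∫ x, ψ (MvPolynomial.eval x f) ∂μ - θ := by
    have h2 : θ < μ.real A := (ENNReal.ofReal_lt_iff_lt_toReal hθ0.le (measure_ne_top _ _)).1 hcon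
    have h3 : μ.real A ≤ ∫ x, ψ (MvPolynomial.eval x f) ∂μ := by
      rw [← integral_indicator_one hAm]
      refine integral_mono ((integrable_const 1).indicator hAm) (hint _ hψc) fun x => ?_
      by_cases hx : x ∈ A
      · have hx' : |MvPolynomial.eval x f| / ε ≤ 1 := (div_le_one hε).2 hx
        simp only [Set.indicator_of_mem hx, Pi.one_apply, ψ]
        exact le_max_of_le_right (le_min le_rfl (by linarith))
      · simp only [Set.indicator_of_notMem hx, ψ]
        exact le_max_left _ _
    linarith
  have h2 : 0 < ∫ x, MvPolynomial.eval x f ^ 2 ∂μ - τ := by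
    have : 0 < c ^ d * coeffd d f ^ 2 := by positivity
    linarith
  let g : Bool → ℝ × (Fin n → ℝ) → ℝ := fun b z =>
    if b then ψ (MvPolynomial.eval z.2 f) - θ else MvPolynomial.eval z.2 f ^ 2 - τ
  obtain ⟨a', b', c', v', w, hw, hw0, hwlc, hpos⟩ := exists_localization α β n 0 1
    (fun z => ∏ i, q (z.2 i)) (by fun_prop) (fun z => hp0 _) (hqlc.prod_comp_snd hq0) g
    (by
      rintro (_ | _)
      · simp only [g, Bool.false_eq_true, if_false]
        exact ((hFc.comp continuous_snd).pow 2).sub continuous_const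
      · simp only [g, if_true]
        exact (hψc.comp continuous_snd).sub continuous_const)
    (by
      rintro (_ | _)
      · simp only [g, Bool.false_eq_true, if_false]
        rw [htrans (fun x => MvPolynomial.eval x f ^ 2) (hFc.pow 2)]
        exact h2
      · simp only [g, if_true]
        rw [htrans (fun x => ψ (MvPolynomial.eval x f)) hψc]
        exact h1)
  obtain ⟨P, hPd, hP⟩ := MvPolynomial.exists_polynomial_line hf c'.2 v'.2
  have h3 := hone hw hw0 hwlc hd P hPd hε hθ0 hτ0
    (by have := hpos true; simpa [g, ψ, hP] using this)
    (by have := hpos false; simpa [g, hP] using this)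
  have h4 := two_mul_rpow_lt_smallBall_bound hd hC₁ hc0 hcoef hε
  rw [← hθ, ← hτ] at h4
  linarith

theorem coeffd_sub_C {n d : ℕ} (hd : 0 < d) (f : MvPolynomial (Fin n) ℝ) (y : ℝ) :
    coeffd d (f - MvPolynomial.C y) = coeffd d f := by
  classical
  have hco : ∀ m : Fin n →₀ ℕ, ∑ i, m i = d →
      (f - MvPolynomial.C y).coeff m = f.coeff m := by
    intro m hm
    have : m ≠ 0 := by
      rintro rfl
      simp at hm
      omega
    rw [MvPolynomial.coeff_sub, MvPolynomial.coeff_C, if_neg this.symm, sub_zero]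
  unfold coeffd
  congr 1
  have hS : (f - MvPolynomial.C y).support.filter (fun m => (∑ i, m i) = d) =
      f.support.filter (fun m => (∑ i, m i) = d) := by
    ext m
    simp only [Finset.mem_filter, MvPolynomial.mem_support_iff]
    constructor <;> rintro ⟨h, hm⟩ <;> refine ⟨?_, hm⟩
    · rwa [hco m hm] at h
    · rwa [hco m hm]
  rw [hS]
  exact Finset.sum_congr rfl fun m hm => by rw [hco m (Finset.mem_filter.1 hm).2]

/-- sublevel (small-ball) estimate for polynomials of isotropic log-concave
product measures, in terms of the `d`-level content. -/
theorem stmt3 :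
    ∃ C > 0, ∀ (ν : Measure ℝ), IsProbabilityMeasure ν → IsLogConcaveMeasure ν →
      (∫ x, x ∂ν = 0) → (∫ x, x ^ 2 ∂ν = 1) →
      ∀ (n d : ℕ), 0 < d → ∀ f : MvPolynomial (Fin n) ℝ, f.totalDegree ≤ d →
        0 < coeffd d f → ∀ (y : ℝ) (ε : ℝ), 0 < ε →
        (Measure.pi fun _ : Fin n => ν) {x | |MvPolynomial.eval x f - y| ≤ ε} ≤
          ENNReal.ofReal (C * d * (ε / coeffd d f) ^ ((1 : ℝ) / d)) := by
  obtain ⟨M, hM, htr⟩ := exists_truncation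
  obtain ⟨C, hC, hball⟩ := exists_smallBall_of_density hM
  refine ⟨C, hC, ?_⟩
  intro ν hνp hνlc hmean hvar n d hd f hf hcoef y ε hε
  have hcoef' : 0 < coeffd d (f - MvPolynomial.C y) := by rwa [coeffd_sub_C hd]
  have hf' : (f - MvPolynomial.C y).totalDegree ≤ d :=
    (MvPolynomial.totalDegree_sub _ _).trans (by simpa using hf)
  set A := {x : Fin n → ℝ | |MvPolynomial.eval x f - y| ≤ ε} with hA
  refine ENNReal.le_of_forall_pos_le_add fun e he _ => ?_
  set δ : ℝ := min 1 (e / (n + 1)) with hδ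
  have he' : (0 : ℝ) < e := by exact_mod_cast he
  have hδ0 : 0 < δ := lt_min one_pos (by positivity)
  have hδ1 : δ ≤ 1 := min_le_left _ _
  have hδe : n * δ ≤ e := by
    calc n * δ ≤ (n + 1) * (e / (n + 1)) := by
          have : δ ≤ e / (n + 1) := min_le_right _ _
          gcongr
          linarith
      _ = e := by field_simp
  obtain ⟨α, β, q, hq, hq0, hqlc, hq1, hqM, hle, hmass⟩ := htr ν hνp hνlc hmean hvar δ hδ0
  set J := Set.Icc α β with hJ
  set B := Set.univ.pi fun _ : Fin n => J with hB
  have hBm : MeasurableSet B := MeasurableSet.univ_pi fun _ => measurableSet_Icc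
  have h1 : (Measure.pi fun _ : Fin n => ν) (A ∩ B) ≤
      ENNReal.ofReal (C * d * (ε / coeffd d f) ^ ((1 : ℝ) / d)) := by
    have := hball α β q hq hq0 hqlc hq1 hqM n d hd _ hf' hcoef' ε hε
    rw [coeffd_sub_C hd] at this
    rw [← Measure.restrict_apply' hBm, hB, Measure.restrict_pi_pi]
    refine (Measure.pi_le_pi (fun _ => hle) A).trans ?_
    simpa [hA] using this
  have h2 : (Measure.pi fun _ : Fin n => ν) Bᶜ ≤ e := by
    rw [prob_compl_eq_one_sub hBm, hB, Measure.pi_pi]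
    simp only [Finset.prod_const, Finset.card_univ, Fintype.card_fin]
    have h3 : 1 - n * δ ≤ (ν.real J) ^ n := by
      have h4 := one_add_mul_le_pow (a := -δ) (by linarith) n
      calc 1 - n * δ ≤ (1 - δ) ^ n := by
            rw [sub_eq_add_neg 1 δ]
            linarith
        _ ≤ _ := pow_le_pow_left₀ (by linarith) hmass n
    have h5 : ENNReal.ofReal (1 - e) ≤ ν J ^ n := by
      rw [← ofReal_measureReal, ← ENNReal.ofReal_pow measureReal_nonneg]
      exact ENNReal.ofReal_le_ofReal (by linarith)
    rw [tsub_le_iff_right]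
    calc (1 : ENNReal) = ENNReal.ofReal (e + (1 - e)) := by simp
      _ ≤ ENNReal.ofReal e + ENNReal.ofReal (1 - e) := ENNReal.ofReal_add_le
      _ ≤ _ := by
        rw [ENNReal.ofReal_coe_nnreal]
        gcongr
  calc (Measure.pi fun _ : Fin n => ν) A
      ≤ (Measure.pi fun _ : Fin n => ν) (A ∩ B) + (Measure.pi fun _ : Fin n => ν) Bᶜ := by
        refine (measure_mono ?_).trans (measure_union_le _ _)
        intro x hx
        by_cases hxB : x ∈ B
        · exact Or.inl ⟨hx, hxB⟩
        · exact Or.inr hxB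
    _ ≤ _ := add_le_add h1 h2
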